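/- arXiv:1607.03052 — 4 statements merged into one kernel-verified Lean document; each statement's English description precedes it below -/
import Mathlib

section
/- Let F = G1 ∗ ⋯ ∗ G_m be the free product of m ≥ 3 nontrivial groups, fix nontrivial elements g_α ∈ G_α for α = 1, …, m, set w_α := g_{α+1}⋯g_m·g_1⋯g_α ∈ F, and let μ: F → F be the group homomorphism determined by μ(a) = w_α⁻¹ a w_α for all a ∈ G_α and all α. Then μ is injective. -/
open Monoid

section Defs

variable {F : Type} [Group F]

def conjS (t : F) (K : Subgroup F) : Subgroup F := K.map (MulAut.conj t).toMonoidHom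

noncomputable def rk (H : Subgroup F) : ℕ :=
  sInf {n : ℕ | ∃ S : Finset F, S.card = n ∧ Subgroup.closure (S : Set F) = H}

noncomputable def rrk (H : Subgroup F) : ℕ := rk H - 1

def dcSetoid (H K : Subgroup F) : Setoid F where
  r s t := ∃ h ∈ H, ∃ k ∈ K, h * s * k = t
  iseqv := by
    refine ⟨fun s => ⟨1, H.one_mem, 1, K.one_mem, by group⟩, ?_, ?_⟩
    · rintro s t ⟨h, hh, k, hk, rfl⟩
      exact ⟨h⁻¹, H.inv_mem hh, k⁻¹, K.inv_mem hk, by group⟩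
    · rintro s t u ⟨h, hh, k, hk, rfl⟩ ⟨h', hh', k', hk', rfl⟩
      exact ⟨h' * h, H.mul_mem hh' hh, k * k', K.mul_mem hk hk', by group⟩

noncomputable def rrkInter (H K : Subgroup F) : ℕ :=
  finsum fun q : Quotient (dcSetoid H K) => rrk (H ⊓ conjS q.out K)

def Noncyclic (H : Subgroup F) : Prop := ∀ g : F, H ≠ Subgroup.closure {g}

end Defs

section Mu

variable {m : ℕ} {G : Fin m → Type} [∀ i, Group (G i)]

/-- A subgroup of the free product `∗_α G_α` is factor-free if it meets every conjugate
of every factor trivially. -/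
def FactorFreeI (H : Subgroup (CoprodI G)) : Prop :=
  ∀ (s : CoprodI G) (i : Fin m),
    H ⊓ conjS s (CoprodI.of : G i →* CoprodI G).range = ⊥

/-- The element `w_α = g_{α+1} ⋯ g_m · g_1 ⋯ g_α` of `F = G_1 ∗ ⋯ ∗ G_m`:
the cyclic permutation of the word `g_1 g_2 ⋯ g_m` beginning right after `g_α`. -/
def wcyc (g : ∀ i, G i) (α : Fin m) : CoprodI G :=
  ((List.ofFn fun i => CoprodI.of (g i)).drop (α.1 + 1)).prod *
    ((List.ofFn fun i => CoprodI.of (g i)).take (α.1 + 1)).prod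

/-- The length `|W|` of an element of the free product: the number of letters of the
unique reduced word representing it. -/
noncomputable def wlen (w : CoprodI G) : ℕ :=
  letI : ∀ i, DecidableEq (G i) := fun _ => Classical.decEq _
  (CoprodI.Word.equiv w).toList.length

/-- `W` is cyclically reduced: the reduced word representing `W²` has length `2|W|`. -/
def CyclRed (w : CoprodI G) : Prop := wlen (w * w) = 2 * wlen w

/-- The image of the factor `G_i` in the free product. -/
def factorRange (i : Fin m) : Subgroup (CoprodI G) :=
  (CoprodI.of : G i →* CoprodI G).range

/-- The subgroup `G(2,m)` of `F` generated by all the factors other than `G_{i0}`. -/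
def tailSub (i0 : Fin m) : Subgroup (CoprodI G) :=
  ⨆ (i : Fin m) (_ : i ≠ i0), (factorRange i : Subgroup (CoprodI G))

end Mu

namespace Monoid.CoprodI.NeWord

theorem prod_ne_one {ι : Type*} {M : ι → Type*} [∀ i, Monoid (M i)] {i j : ι}
    (w : NeWord M i j) : w.prod ≠ 1 := by
  classical
  intro h
  have h' : w.toWord = Word.empty := by
    apply Word.equiv.symm.injective
    simpa [Word.equiv, NeWord.prod] using h
  exact w.toList_ne_nil (congrArg Word.toList h')

theorem exists_prod_eq_of_nodup {ι : Type*} {M : ι → Type*} [∀ i, Monoid (M i)]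
    (g : ∀ i, M i) (hg : ∀ i, g i ≠ 1) (t : List ι) (k i : ι) (h : (k :: (t ++ [i])).Nodup) :
    ∃ W : NeWord M k i, W.prod = ((k :: (t ++ [i])).map fun j => of (g j)).prod := by
  induction t generalizing k with
  | nil =>
    have hki : k ≠ i := by simpa using h
    exact ⟨append (singleton (g k) (hg k)) hki (singleton (g i) (hg i)), by simp⟩
  | cons l t ih =>
    rw [List.cons_append] at h ⊢
    obtain ⟨W, hW⟩ := ih l h.of_cons
    have hkl : k ≠ l := by
      rintro rfl
      simp at h
    exact ⟨append (singleton (g k) (hg k)) hkl W, by simp [hW]⟩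

end Monoid.CoprodI.NeWord

open Monoid.CoprodI in
theorem exists_neWord_prod_eq_wcyc {m : ℕ} (hm : 2 ≤ m) {G : Fin m → Type} [∀ i, Group (G i)]
    (g : ∀ i, G i) (hg : ∀ i, g i ≠ 1) (i : Fin m) :
    ∃ k, k ≠ i ∧ ∃ W : NeWord G k i, W.prod = wcyc g i := by
  set L := (List.finRange m).drop (i.1 + 1) ++ (List.finRange m).take i.1 with hL
  have htake : (List.finRange m).take (i.1 + 1) = (List.finRange m).take i.1 ++ [i] := by
    rw [List.take_add_one]
    simp
  have hrot : L ++ [i] = (List.finRange m).rotate (i.1 + 1) := by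
    rw [List.rotate_eq_drop_append_take (by simp), htake, hL, List.append_assoc]
  have hnodup : (L ++ [i]).Nodup := by
    rw [hrot, List.nodup_rotate]
    exact List.nodup_finRange m
  have hprod : ((L ++ [i]).map fun j => (of (g j) : CoprodI G)).prod = wcyc g i := by
    rw [wcyc, List.ofFn_eq_map, ← List.map_drop, ← List.map_take, htake, ← List.prod_append,
      ← List.map_append, hL, List.append_assoc]
  have hlen : L.length + 1 = m := by
    simpa using congrArg List.length hrot
  match L, hnodup, hprod, hlen with
  | [], _, _, hlen => simp at hlen; omega
  | k :: t, hnodup, hprod, _ =>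
    obtain ⟨W, hW⟩ := NeWord.exists_prod_eq_of_nodup g hg t k i hnodup
    refine ⟨k, ?_, W, hW.trans hprod⟩
    rintro rfl
    simp at hnodup

/-- Lemma 5.3: the homomorphism `μ` of `F = G_1 ∗ ⋯ ∗ G_m` determined by
`a ↦ w_α⁻¹ a w_α` for `a ∈ G_α` is injective. -/
theorem statement10 {m : ℕ} (hm : 3 ≤ m) {G : Fin m → Type} [∀ i, Group (G i)]
    [∀ i, Nontrivial (G i)] (g : ∀ i, G i) (hg : ∀ i, g i ≠ 1)
    (μ : CoprodI G →* CoprodI G)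
    (hμ : ∀ (α : Fin m) (a : G α),
      μ (CoprodI.of a) = (wcyc g α)⁻¹ * CoprodI.of a * wcyc g α) :
    Function.Injective μ := by
  classical
  have image_neWord : ∀ {i j : Fin m} (w : CoprodI.NeWord G i j),
      ∃ w' : CoprodI.NeWord G i j, w'.prod = μ w.prod := by
    intro i j w
    induction w with
    | @singleton i x hx =>
      obtain ⟨k, hk, W, hW⟩ := exists_neWord_prod_eq_wcyc (by omega) g hg i
      exact ⟨.append (.append W.inv hk (.singleton x hx)) hk.symm W, by simp [hW, hμ]⟩
    | append w₁ hne w₂ ih₁ ih₂ =>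
      obtain ⟨w₁', h₁⟩ := ih₁
      obtain ⟨w₂', h₂⟩ := ih₂
      exact ⟨.append w₁' hne w₂', by simp [h₁, h₂]⟩
  rw [injective_iff_map_eq_one]
  intro x hx
  obtain ⟨w, rfl⟩ := CoprodI.Word.equiv.symm.surjective x
  by_cases hw : w = CoprodI.Word.empty
  · simp [hw, CoprodI.Word.equiv]
  · obtain ⟨i, j, v, rfl⟩ := CoprodI.NeWord.of_word w hw
    obtain ⟨v', hv'⟩ := image_neWord v
    exact absurd (hv'.trans hx) v'.prod_ne_one
end

section
/- Let F = G1 ∗ ⋯ ∗ G_m be the free product of m ≥ 3 nontrivial groups, fix nontrivial g_α ∈ G_α, set w_α := g_{α+1}⋯g_m·g_1⋯g_α, and let μ: F → F be the homomorphism with μ(a) = w_α⁻¹ a w_α for a ∈ G_α. Then for every U ∈ F with |U| > 1, the element U is cyclically reduced if and only if μ(U) is cyclically reduced. -/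
open Monoid

namespace Monoid.CoprodI

variable {m : ℕ} {G : Fin m → Type} [∀ i, Group (G i)]

theorem wlen_neWord_prod {i j : Fin m} (w : NeWord G i j) : wlen w.prod = w.toList.length := by
  classical
  have h : Word.equiv w.prod = w.toWord := Word.equiv.apply_symm_apply w.toWord
  unfold wlen
  convert congrArg (fun v => v.toList.length) h
  rfl

theorem Word.length_of_smul_le [∀ i, DecidableEq (G i)] {i : Fin m} (a : G i) (w : Word G) :
    (of a • w).toList.length ≤ w.toList.length + 1 := by
  have h1 : ∀ p : Word.Pair G i, (Word.rcons p).toList.length ≤ p.tail.toList.length + 1 := by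
    intro p
    unfold Word.rcons
    split_ifs <;> simp [Word.cons]
  have h2 : ∀ p : Word.Pair G i, p.tail.toList.length ≤ (Word.rcons p).toList.length := by
    intro p
    unfold Word.rcons
    split_ifs <;> simp [Word.cons]
  have h3 := h2 (Word.equivPair i w)
  rw [← Word.equivPair_symm, Equiv.symm_apply_apply] at h3
  rw [Word.of_smul_def]
  exact (h1 _).trans (Nat.add_le_add_right h3 1)

theorem wlen_list_prod_le (l : List (Σ i, G i)) :
    wlen (l.map fun p => (of p.2 : CoprodI G)).prod ≤ l.length := by
  unfold wlen
  induction l with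
  | nil => simp [Word.equiv, Word.empty]
  | cons p l ih =>
    simp only [List.map_cons, List.prod_cons, List.length_cons]
    refine le_trans ?_ (Nat.add_le_add_right ih 1)
    have h := fun d : ∀ i, DecidableEq (G i) =>
      Word.length_of_smul_le p.2 (Word.equiv (l.map fun p => (of p.2 : CoprodI G)).prod)
    simp only [Word.equiv, Equiv.coe_fn_mk, mul_smul] at h ⊢
    exact h _

theorem cyclRed_neWord_prod_iff {i j : Fin m} (w : NeWord G i j) : CyclRed w.prod ↔ i ≠ j := by
  constructor
  · rintro h rfl
    obtain ⟨L, hL⟩ : ∃ L, w.toList = L ++ [⟨i, w.last⟩] :=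
      ⟨_, (List.dropLast_append_getLast? _ w.toList_getLast?).symm⟩
    obtain ⟨R, hR⟩ : ∃ R, w.toList = ⟨i, w.head⟩ :: R :=
      ⟨_, List.eq_cons_of_mem_head? w.toList_head?⟩
    have hw : w.prod = (w.toList.map fun p => (of p.2 : CoprodI G)).prod := rfl
    have hmul : w.prod * w.prod =
        ((L ++ ⟨i, w.last * w.head⟩ :: R).map fun p => (of p.2 : CoprodI G)).prod := by
      conv_lhs => rw [hw]
      conv_lhs => arg 1; rw [hL]
      conv_lhs => arg 2; rw [hR]
      simp [mul_assoc]
    have hle := wlen_list_prod_le (L ++ ⟨i, w.last * w.head⟩ :: R)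
    rw [← hmul, h, wlen_neWord_prod] at hle
    have hL' := congrArg List.length hL
    have hR' := congrArg List.length hR
    simp only [List.length_append, List.length_cons, List.length_nil] at hle hL' hR'
    omega
  · intro h
    unfold CyclRed
    rw [← NeWord.append_prod (hne := h.symm), wlen_neWord_prod, wlen_neWord_prod, NeWord.toList,
      List.length_append, two_mul]

theorem exists_neWord_prod_eq_take (g : ∀ i, G i) (hg : ∀ i, g i ≠ 1) (n : ℕ) (hn : n < m) :
    ∃ v : NeWord G ⟨0, by omega⟩ ⟨n, hn⟩,
      v.prod = ((List.ofFn fun i => of (g i)).take (n + 1)).prod := by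
  induction n with
  | zero =>
    refine ⟨.singleton _ (hg _), ?_⟩
    rw [List.prod_take_succ _ _ (by simpa using hn)]
    simp
  | succ n ih =>
    obtain ⟨v, hv⟩ := ih (by omega)
    refine ⟨.append v (by simp) (.singleton _ (hg _)), ?_⟩
    rw [List.prod_take_succ _ _ (by simpa using hn), NeWord.append_prod, hv]
    simp

theorem exists_neWord_prod_eq_drop (g : ∀ i, G i) (hg : ∀ i, g i ≠ 1) (n k : ℕ)
    (hn : n + k + 1 = m) :
    ∃ v : NeWord G ⟨n, by omega⟩ ⟨m - 1, by omega⟩,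
      v.prod = ((List.ofFn fun i => of (g i)).drop n).prod := by
  induction k generalizing n with
  | zero =>
    obtain rfl : n = m - 1 := by omega
    refine ⟨.singleton _ (hg _), ?_⟩
    rw [List.drop_eq_getElem_cons (by simp; omega), List.drop_eq_nil_of_le (by simp; omega)]
    simp
  | succ k ih =>
    obtain ⟨v, hv⟩ := ih (n + 1) (by omega)
    refine ⟨.append (.singleton _ (hg _)) (by simp) v, ?_⟩
    rw [List.drop_eq_getElem_cons (by simp; omega), NeWord.append_prod, hv]
    simp

theorem exists_neWord_prod_eq_wcyc (hm : 2 ≤ m) (g : ∀ i, G i) (hg : ∀ i, g i ≠ 1) (α : Fin m) :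
    ∃ s, s ≠ α ∧ ∃ v : NeWord G s α, v.prod = wcyc g α := by
  obtain ⟨v, hv⟩ := exists_neWord_prod_eq_take g hg α.1 α.2
  by_cases h : α.1 + 1 = m
  · refine ⟨⟨0, by omega⟩, by rw [Ne, Fin.ext_iff]; dsimp only; omega, v, ?_⟩
    rw [hv, wcyc, List.drop_eq_nil_of_le (by simp; omega)]
    simp
  · obtain ⟨u, hu⟩ := exists_neWord_prod_eq_drop g hg (α.1 + 1) (m - (α.1 + 2)) (by omega)
    refine ⟨⟨α.1 + 1, by omega⟩, by simp [Fin.ext_iff],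
      .append u (by rw [Ne, Fin.ext_iff]; dsimp only; omega) v, ?_⟩
    rw [NeWord.append_prod, hu, hv, wcyc]

theorem exists_neWord_prod_eq_map (hm : 2 ≤ m) (g : ∀ i, G i) (hg : ∀ i, g i ≠ 1)
    (μ : CoprodI G →* CoprodI G)
    (hμ : ∀ (α : Fin m) (a : G α), μ (of a) = (wcyc g α)⁻¹ * of a * wcyc g α)
    {i j : Fin m} (w : NeWord G i j) : ∃ v : NeWord G i j, v.prod = μ w.prod := by
  induction w with
  | @singleton i a ha =>
    obtain ⟨s, hs, v, hv⟩ := exists_neWord_prod_eq_wcyc hm g hg i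
    refine ⟨.append (.append v.inv hs (.singleton a ha)) hs.symm v, ?_⟩
    simp [hμ, hv]
  | append w₁ hne w₂ ih₁ ih₂ =>
    obtain ⟨v₁, h₁⟩ := ih₁
    obtain ⟨v₂, h₂⟩ := ih₂
    exact ⟨.append v₁ hne v₂, by simp [h₁, h₂]⟩

theorem exists_neWord_prod_eq {U : CoprodI G} (hU : 0 < wlen U) :
    ∃ (i j : Fin m) (w : NeWord G i j), w.prod = U := by
  let d : ∀ i, DecidableEq (G i) := fun _ => Classical.decEq _
  obtain ⟨i, j, w, hw⟩ := NeWord.of_word (Word.equiv U) fun h => by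
    have h0 : 0 < (Word.equiv U).toList.length := hU
    simp [h, Word.empty] at h0
  exact ⟨i, j, w, by rw [NeWord.prod, hw]; exact Word.equiv.symm_apply_apply U⟩

end Monoid.CoprodI

/-- Lemma 5.3(a): for every `U ∈ F` with `|U| > 1`, `U` is cyclically
reduced if and only if `μ(U)` is cyclically reduced. -/
theorem statement11 {m : ℕ} (hm : 3 ≤ m) {G : Fin m → Type} [∀ i, Group (G i)]
    [∀ i, Nontrivial (G i)] (g : ∀ i, G i) (hg : ∀ i, g i ≠ 1)
    (μ : CoprodI G →* CoprodI G)
    (hμ : ∀ (α : Fin m) (a : G α),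
      μ (CoprodI.of a) = (wcyc g α)⁻¹ * CoprodI.of a * wcyc g α)
    (U : CoprodI G) (hU : 1 < wlen U) :
    CyclRed U ↔ CyclRed (μ U) := by
  obtain ⟨i, j, w, rfl⟩ := CoprodI.exists_neWord_prod_eq (Nat.zero_lt_of_lt hU)
  obtain ⟨v, hv⟩ := CoprodI.exists_neWord_prod_eq_map (by omega) g hg μ hμ w
  rw [← hv, CoprodI.cyclRed_neWord_prod_iff, CoprodI.cyclRed_neWord_prod_iff]
end

section
/- Let F = G1 ∗ ⋯ ∗ G_m be the free product of m ≥ 3 nontrivial groups, fix nontrivial g_α ∈ G_α, set w_α := g_{α+1}⋯g_m·g_1⋯g_α, and let μ: F → F be the homomorphism with μ(a) = w_α⁻¹ a w_α for a ∈ G_α. Then the image subgroup μ(F) is antinormal in F: for every W ∈ F, if W μ(F) W⁻¹ ∩ μ(F) ≠ {1}, then W ∈ μ(F). -/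
open Monoid

namespace FreeProductWord

section Words

variable {ι : Type*} {G : ι → Type*} [∀ i, Group (G i)]

/-- The element of the free product represented by a list of letters. -/
def listProd (L : List (Σ i, G i)) : CoprodI G := (L.map fun l => CoprodI.of l.2).prod

/-- A list of letters is reduced if it is the underlying list of a `CoprodI.Word`. -/
def Reduced (L : List (Σ i, G i)) : Prop :=
  (∀ l ∈ L, l.2 ≠ 1) ∧ L.IsChain fun l l' => l.1 ≠ l'.1

/-- The formal inverse of a letter. -/
def letterInv (l : Σ i, G i) : Σ i, G i := ⟨l.1, l.2⁻¹⟩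

@[simp] lemma letterInv_letterInv (l : Σ i, G i) : letterInv (letterInv l) = l :=
  Sigma.ext rfl (heq_of_eq (inv_inv _))

/-- The formal inverse of a list of letters. -/
def listInv (L : List (Σ i, G i)) : List (Σ i, G i) := (L.map letterInv).reverse

@[simp] lemma listProd_nil : listProd ([] : List (Σ i, G i)) = 1 := rfl

@[simp] lemma listProd_cons (l : Σ i, G i) (L : List (Σ i, G i)) :
    listProd (l :: L) = CoprodI.of l.2 * listProd L := by
  simp [listProd]

@[simp] lemma listProd_append (L M : List (Σ i, G i)) :
    listProd (L ++ M) = listProd L * listProd M := by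
  simp [listProd]

@[simp] lemma length_listInv (L : List (Σ i, G i)) : (listInv L).length = L.length := by
  simp [listInv]

@[simp] lemma listInv_listInv (L : List (Σ i, G i)) : listInv (listInv L) = L := by
  simp [listInv, Function.comp_def, letterInv_letterInv]

@[simp] lemma listProd_listInv (L : List (Σ i, G i)) : listProd (listInv L) = (listProd L)⁻¹ := by
  induction L with
  | nil => simp [listInv]
  | cons l L ih =>
    have : listInv (l :: L) = listInv L ++ [letterInv l] := by simp [listInv]
    rw [this, listProd_append, ih]
    simp [letterInv]

lemma Reduced.inv {L : List (Σ i, G i)} (h : Reduced L) : Reduced (listInv L) := by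
  refine ⟨?_, ?_⟩
  · intro l hl
    simp only [listInv, List.mem_reverse, List.mem_map] at hl
    obtain ⟨a, ha, rfl⟩ := hl
    exact inv_ne_one.2 (h.1 a ha)
  · rw [listInv, List.isChain_reverse, List.isChain_map]
    exact h.2.imp fun _ _ h => h.symm

lemma exists_reduced (x : CoprodI G) : ∃ L, Reduced L ∧ listProd L = x := by
  classical
  exact ⟨(CoprodI.Word.equiv x).toList, ⟨(CoprodI.Word.equiv x).ne_one,
    (CoprodI.Word.equiv x).chain_ne⟩, CoprodI.Word.equiv.symm_apply_apply x⟩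

lemma Reduced.eq_of_listProd_eq {L M : List (Σ i, G i)} (hL : Reduced L) (hM : Reduced M)
    (h : listProd L = listProd M) : L = M := by
  classical
  have := CoprodI.Word.equiv.symm.injective
    (a₁ := (⟨L, hL.1, hL.2⟩ : CoprodI.Word G)) (a₂ := ⟨M, hM.1, hM.2⟩) h
  exact congrArg CoprodI.Word.toList this

lemma reduced_append {L M : List (Σ i, G i)} :
    Reduced (L ++ M) ↔ Reduced L ∧ Reduced M ∧
      ∀ x ∈ L.getLast?, ∀ y ∈ M.head?, x.1 ≠ y.1 := by
  simp only [Reduced, List.isChain_append, List.mem_append]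
  grind

lemma reduced_cons {l : Σ i, G i} {M : List (Σ i, G i)} :
    Reduced (l :: M) ↔ l.2 ≠ 1 ∧ Reduced M ∧ ∀ y ∈ M.head?, l.1 ≠ y.1 := by
  simp only [Reduced, List.isChain_cons, List.mem_cons]
  grind

lemma reduced_nil : Reduced ([] : List (Σ i, G i)) := by simp [Reduced]

lemma exists_reduced_of_mul (l : Σ i, G i) (hl : l.2 ≠ 1) (X : List (Σ i, G i))
    (hX : Reduced X) : ∃ Z, Reduced Z ∧ listProd Z = CoprodI.of l.2 * listProd X ∧
      X.drop 1 <:+ Z ∧ Z.length ≤ X.length + 1 := by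
  cases X with
  | nil => exact ⟨[l], by simp [Reduced, hl], by simp, by simp, by simp⟩
  | cons x X =>
    by_cases h : l.1 = x.1
    · obtain ⟨i, a⟩ := l
      obtain ⟨j, b⟩ := x
      obtain rfl : i = j := h
      have hX' := reduced_cons.1 hX
      by_cases hab : a * b = 1
      · refine ⟨X, hX'.2.1, ?_, by simp, by simp; omega⟩
        rw [listProd_cons, ← mul_assoc, ← map_mul, hab, map_one, one_mul]
      · exact ⟨⟨i, a * b⟩ :: X, reduced_cons.2 ⟨hab, hX'.2⟩, by simp [mul_assoc], by simp, by simp⟩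
    · refine ⟨l :: x :: X, reduced_cons.2 ⟨hl, hX, by simpa using h⟩, by simp, ?_, by simp⟩
      exact ⟨[l, x], rfl⟩

/-- Multiplying by `W` on the left changes only the first `|W|` letters of a reduced list. -/
lemma exists_reduced_mul (W X : List (Σ i, G i)) (hW : Reduced W) (hX : Reduced X) :
    ∃ Z, Reduced Z ∧ listProd Z = listProd W * listProd X ∧
      X.drop W.length <:+ Z ∧ Z.length ≤ X.length + W.length := by
  induction W with
  | nil => exact ⟨X, hX, by simp, by simp, by simp⟩
  | cons l W ih =>
    have hW' := reduced_cons.1 hW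
    obtain ⟨Z, hZ, hZp, hs, hlen⟩ := ih hW'.2.1
    obtain ⟨Z', hZ', hZp', hs', hlen'⟩ := exists_reduced_of_mul l hW'.1 Z hZ
    refine ⟨Z', hZ', by simp [hZp', hZp, mul_assoc], ?_, by simp; omega⟩
    refine List.IsSuffix.trans ?_ hs'
    obtain ⟨S, rfl⟩ := hs
    rw [List.length_cons, ← List.drop_drop]
    cases S with
    | nil => exact List.suffix_rfl
    | cons s S => exact (List.drop_suffix _ _).trans (List.suffix_append _ _)

lemma Reduced.drop_suffix {W X L : List (Σ i, G i)} (hW : Reduced W) (hX : Reduced X)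
    (hL : Reduced L) (h : listProd L = listProd W * listProd X) :
    X.drop W.length <:+ L := by
  obtain ⟨Z, hZ, hZp, hs, -⟩ := exists_reduced_mul W X hW hX
  rwa [hL.eq_of_listProd_eq hZ (h.trans hZp.symm)]

lemma Reduced.length_le {W X L : List (Σ i, G i)} (hW : Reduced W) (hX : Reduced X)
    (hL : Reduced L) (h : listProd L = listProd W * listProd X) :
    L.length ≤ X.length + W.length := by
  obtain ⟨Z, hZ, hZp, -, hs⟩ := exists_reduced_mul W X hW hX
  rwa [hL.eq_of_listProd_eq hZ (h.trans hZp.symm)]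

lemma listInv_suffix_iff {L M : List (Σ i, G i)} (h : listInv L <:+ listInv M) : L <+: M := by
  obtain ⟨S, hS⟩ := h
  refine ⟨listInv S, ?_⟩
  have := congrArg listInv hS
  rw [listInv_listInv] at this
  rw [← this]
  nth_rw 1 [← listInv_listInv L]
  simp [listInv]

lemma Reduced.take_prefix {W Y L : List (Σ i, G i)} (hW : Reduced W) (hY : Reduced Y)
    (hL : Reduced L) (h : listProd L = listProd Y * listProd W) :
    Y.take (Y.length - W.length) <+: L := by
  have := hW.inv.drop_suffix hY.inv hL.inv (by simp [h])
  apply listInv_suffix_iff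
  convert this using 1
  simp [listInv, List.drop_reverse, List.map_take]

lemma flatten_replicate_reduced {P : List (Σ i, G i)} (hP : Reduced P) (hne : P ≠ [])
    (hc : ∀ x ∈ P.head?, ∀ y ∈ P.getLast?, y.1 ≠ x.1) (n : ℕ) :
    Reduced (List.replicate n P).flatten := by
  induction n with
  | zero => exact reduced_nil
  | succ n ih =>
    rw [List.replicate_succ, List.flatten_cons, reduced_append]
    refine ⟨hP, ih, fun x hx y hy => ?_⟩
    cases n with
    | zero => simp at hy
    | succ n =>
      rw [List.replicate_succ, List.flatten_cons, List.head?_append_of_ne_nil _ hne] at hy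
      exact hc y hy x hx

lemma listProd_flatten_replicate (P : List (Σ i, G i)) (n : ℕ) :
    listProd (List.replicate n P).flatten = listProd P ^ n := by
  induction n with
  | zero => simp
  | succ n ih => simp [List.replicate_succ, ih, pow_succ']

/-- Every element of a free product is conjugate either into a factor or to an element with a
cyclically reduced word whose end letters lie in different factors. -/
lemma exists_conj (L : List (Σ i, G i)) (hL : Reduced L) :
    ∃ v : CoprodI G, v * listProd L * v⁻¹ = 1 ∨
      (∃ l : Σ i, G i, v * listProd L * v⁻¹ = CoprodI.of l.2) ∨
      ∃ P, Reduced P ∧ P ≠ [] ∧ (∀ x ∈ P.head?, ∀ y ∈ P.getLast?, y.1 ≠ x.1) ∧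
        v * listProd L * v⁻¹ = listProd P := by
  induction hn : L.length using Nat.strong_induction_on generalizing L with
  | _ n ih =>
  subst hn
  match L, List.eq_nil_or_concat L with
  | [], _ => exact ⟨1, .inl (by simp)⟩
  | [l], _ => exact ⟨1, .inr (.inl ⟨l, by simp⟩)⟩
  | x :: z :: M, h =>
    obtain h | ⟨M', y, h⟩ := h
    · simp at h
    cases M' with
    | nil => simp at h
    | cons x' M' =>
    rw [List.concat_eq_append, List.cons_append, List.cons.injEq] at h
    obtain ⟨rfl, h⟩ := h
    rw [h] at hL ih ⊢
    clear h M z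
    by_cases hxy : y.1 = x.1
    · obtain ⟨i, a⟩ := x
      obtain ⟨j, b⟩ := y
      obtain rfl : j = i := hxy
      have hL1 := reduced_cons.1 hL
      have hL2 := reduced_append.1 hL1.2.1
      have key : CoprodI.of b * listProd (⟨j, a⟩ :: (M' ++ [⟨j, b⟩])) * (CoprodI.of b)⁻¹ =
          CoprodI.of (b * a) * listProd M' := by
        simp [mul_assoc]
      by_cases hba : b * a = 1
      · obtain ⟨v, hv⟩ := ih M'.length (by simp) M' hL2.1 rfl
        rw [hba, map_one, one_mul] at key
        refine ⟨v * CoprodI.of b, ?_⟩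
        rw [← key] at hv
        simpa only [mul_inv_rev, mul_assoc] using hv
      · have hred : Reduced (⟨j, b * a⟩ :: M') := by
          refine reduced_cons.2 ⟨hba, hL2.1, fun y hy => hL1.2.2 y ?_⟩
          cases M' <;> simp_all
        obtain ⟨v, hv⟩ := ih _ (by simp) (⟨j, b * a⟩ :: M') hred rfl
        rw [listProd_cons, ← key] at hv
        refine ⟨v * CoprodI.of b, ?_⟩
        simpa only [mul_inv_rev, mul_assoc] using hv
    · refine ⟨1, .inr (.inr ⟨_, hL, by simp, ?_, by simp⟩)⟩
      simpa [List.getLast?_cons, List.getLast?_append] using hxy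

/-- The factors of a free product are malnormal, and distinct factors have no nontrivial
conjugate elements in common. -/
lemma eq_and_mem_of_conj {α β : ι} {a : G α} {b : G β} (ha : a ≠ 1) (hb : b ≠ 1)
    {V : CoprodI G} (h : V * CoprodI.of a * V⁻¹ = CoprodI.of b) :
    α = β ∧ ∃ c : G α, V = CoprodI.of c := by
  have key : ∀ (M : List (Σ i, G i)) (c : G α), Reduced M →
      (∀ x ∈ M.getLast?, x.1 ≠ α) → V = listProd M * CoprodI.of c →
      α = β ∧ ∃ c : G α, V = CoprodI.of c := by
    intro M c hM hl hV
    have hr : Reduced (M ++ ⟨α, c * a * c⁻¹⟩ :: listInv M) := by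
      refine reduced_append.2 ⟨hM, reduced_cons.2 ⟨?_, hM.inv, ?_⟩, by simpa using hl⟩
      · simpa [mul_inv_eq_one] using ha
      · simp only [listInv, List.head?_reverse, List.getLast?_map]
        intro y hy
        obtain ⟨x, hx, rfl⟩ := Option.map_eq_some_iff.1 hy
        exact (hl x hx).symm
    have hr' : Reduced [(⟨β, b⟩ : Σ i, G i)] := by simp [Reduced, hb]
    have e := hr.eq_of_listProd_eq hr' (by simp [← h, hV, mul_assoc])
    have hlen := congrArg List.length e
    have hM0 : M = [] := by
      rw [← List.length_eq_zero_iff]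
      simp at hlen
      omega
    subst hM0
    simp only [List.nil_append, List.cons.injEq, Sigma.mk.injEq] at e
    exact ⟨e.1.1, c, by simpa using hV⟩
  obtain ⟨L, hL, rfl⟩ := exists_reduced V
  obtain rfl | ⟨M, y, rfl⟩ := List.eq_nil_or_concat L
  · exact key [] 1 reduced_nil (by simp) (by simp)
  · rw [List.concat_eq_append] at *
    have hL' := reduced_append.1 hL
    by_cases hy : y.1 = α
    · obtain ⟨i, c⟩ := y
      obtain rfl : i = α := hy
      exact key M c hL'.1 (fun x hx => hL'.2.2 x hx _ rfl) (by simp)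
    · exact key _ 1 hL (by simpa using hy) (by simp)

end Words

lemma exists_add_mod_eq {N : ℕ} (a r : ℕ) (hr : r < N) : ∃ i < N, (a + i) % N = r := by
  have hN : 0 < N := by omega
  have h1 := Nat.mod_lt a hN
  refine ⟨(r + (N - a % N)) % N, Nat.mod_lt _ hN, ?_⟩
  rw [Nat.add_mod, Nat.mod_mod, ← Nat.add_mod, ← Nat.mod_add_mod,
    show a % N + (r + (N - a % N)) = r + N by omega, Nat.add_mod_right, Nat.mod_eq_of_lt hr]

lemma length_flatMap_const {A B : Type*} {f : A → List B} {N : ℕ} (hf : ∀ a, (f a).length = N)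
    (q : List A) : (q.flatMap f).length = q.length * N := by
  simp [List.length_flatMap, hf]

lemma take_flatMap_const {A B : Type*} {f : A → List B} {N : ℕ} (hf : ∀ a, (f a).length = N)
    (q : List A) (k : ℕ) : (q.flatMap f).take (k * N) = (q.take k).flatMap f := by
  induction q generalizing k with
  | nil => simp
  | cons a q ih =>
    cases k with
    | zero => simp
    | succ k =>
      rw [List.flatMap_cons, List.take_succ_cons, List.flatMap_cons, ← ih, Nat.succ_mul,
        Nat.add_comm, ← hf a, List.take_length_add_append]

lemma drop_flatMap_const {A B : Type*} {f : A → List B} {N : ℕ} (hf : ∀ a, (f a).length = N)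
    (q : List A) (k : ℕ) : (q.flatMap f).drop (k * N) = (q.drop k).flatMap f := by
  induction q generalizing k with
  | nil => simp
  | cons a q ih =>
    cases k with
    | zero => simp
    | succ k =>
      rw [List.flatMap_cons, List.drop_succ_cons, ← ih, Nat.succ_mul,
        Nat.add_comm, ← hf a, List.drop_length_add_append]

lemma getElem?_flatMap_const {A B : Type*} {f : A → List B} {N : ℕ}
    (hf : ∀ a, (f a).length = N) (q : List A) {k r : ℕ}
    (h : k * N + r < (q.flatMap f).length) :
    ∃ a, ∀ r < N, (q.flatMap f)[k * N + r]? = (f a)[r]? := by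
  rw [length_flatMap_const hf] at h
  have hk : k < q.length := by
    by_contra hk
    have := Nat.mul_le_mul_right N (not_lt.1 hk)
    omega
  refine ⟨q[k], fun r hr => ?_⟩
  rw [← List.getElem?_drop, drop_flatMap_const hf, List.drop_eq_getElem_cons hk,
    List.flatMap_cons, List.getElem?_append_left (by rw [hf]; exact hr)]

section Blocks

variable {m : ℕ} {G : Fin m → Type} (g : ∀ i, G i)

/-- The letters of the word `wcyc g α`. -/
def cycList (α : Fin m) : List (Σ i, G i) :=
  (List.ofFn fun i => (⟨i, g i⟩ : Σ i, G i)).rotate (α + 1)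

lemma length_cycList (α : Fin m) : (cycList g α).length = m := by
  simp [cycList]

lemma getElem_cycList (α : Fin m) {p : ℕ} (hp : p < (cycList g α).length) :
    ((cycList g α)[p].1 : ℕ) = (α + p + 1) % m := by
  simp only [cycList, List.getElem_rotate, List.getElem_ofFn, List.length_ofFn]
  congr 1
  ring

variable [∀ i, Group (G i)]

lemma listProd_cycList (α : Fin m) : listProd (cycList g α) = wcyc g α := by
  rw [cycList, List.rotate_eq_drop_append_take (by simp), listProd_append]
  simp only [listProd, wcyc, List.map_drop, List.map_take, List.map_ofFn]
  rfl

/-- The reduced word of the image under `μ` of a single letter. -/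
def block (l : Σ i, G i) : List (Σ i, G i) :=
  listInv (cycList g l.1) ++ l :: cycList g l.1

lemma length_block (l : Σ i, G i) : (block g l).length = 2 * m + 1 := by
  simp [block, length_cycList]
  ring

lemma listProd_block (l : Σ i, G i) :
    listProd (block g l) = (wcyc g l.1)⁻¹ * CoprodI.of l.2 * wcyc g l.1 := by
  simp [block, listProd_cycList, mul_assoc]

lemma block_fst_of_le (l : Σ i, G i) {p : ℕ} (hp : p ≤ m) :
    ∃ h, (((block g l)[p]'h).1 : ℕ) = (l.1 + (m - p)) % m := by
  refine ⟨by rw [length_block]; omega, ?_⟩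
  rcases hp.lt_or_eq with hp | rfl
  · simp only [block]
    rw [List.getElem_append_left (by simpa [length_cycList] using hp)]
    simp only [listInv, List.getElem_reverse, List.getElem_map, letterInv, getElem_cycList,
      List.length_map, length_cycList]
    congr 1
    omega
  · simp only [block]
    rw [List.getElem_append_right (by simp [length_cycList])]
    simp [length_cycList, Nat.mod_eq_of_lt]

lemma block_fst_of_ge (l : Σ i, G i) {p : ℕ} (hp : m ≤ p) (hp' : p ≤ 2 * m) :
    ∃ h, (((block g l)[p]'h).1 : ℕ) = (l.1 + p) % m := by
  refine ⟨by rw [length_block]; omega, ?_⟩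
  obtain ⟨p, rfl⟩ := Nat.exists_eq_add_of_le hp
  simp only [block]
  rw [List.getElem_append_right (by simp [length_cycList])]
  cases p with
  | zero => simp [length_cycList, Nat.mod_eq_of_lt]
  | succ p =>
    simp only [length_listInv, length_cycList, Nat.add_sub_cancel_left, List.getElem_cons_succ,
      getElem_cycList]
    rw [show (l.1 : ℕ) + (m + (p + 1)) = l.1 + p + 1 + m by ring, Nat.add_mod_right]

lemma add_one_mod_ne {t : ℕ} (hm : 2 ≤ m) : (t + 1) % m ≠ t % m := by
  intro h
  have : 1 ≡ 0 [MOD m] := Nat.ModEq.add_left_cancel' t h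
  have := (Nat.modEq_zero_iff_dvd.1 this)
  have := Nat.le_of_dvd one_pos this
  omega

lemma reduced_block (hm : 2 ≤ m) (hg : ∀ i, g i ≠ 1) {l : Σ i, G i} (hl : l.2 ≠ 1) :
    Reduced (block g l) := by
  constructor
  · have hcyc : ∀ x ∈ cycList g l.1, x.2 ≠ 1 := by
      intro x hx
      simp only [cycList, List.mem_rotate, List.mem_ofFn] at hx
      obtain ⟨i, rfl⟩ := hx
      exact hg i
    intro x hx
    simp only [block, listInv, List.mem_append, List.mem_cons, List.mem_reverse,
      List.mem_map] at hx
    obtain ⟨y, hy, rfl⟩ | rfl | hx := hx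
    · exact inv_ne_one.2 (hcyc y hy)
    · exact hl
    · exact hcyc x hx
  · rw [List.isChain_iff_getElem]
    intro p hp h
    have h := congrArg Fin.val h
    rw [length_block] at hp
    rcases lt_or_ge p m with hpm | hpm
    · rw [(block_fst_of_le g l hpm.le).2, (block_fst_of_le g l (Nat.succ_le_of_lt hpm)).2,
        show m - p = m - (p + 1) + 1 by omega] at h
      exact add_one_mod_ne hm h
    · rw [(block_fst_of_ge g l hpm (by omega)).2,
        (block_fst_of_ge g l (p := p + 1) (by omega) (by omega)).2] at h
      exact add_one_mod_ne hm h.symm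

lemma head?_block_fst (l : Σ i, G i) : ∀ x ∈ (block g l).head?, x.1 = l.1 := by
  intro x hx
  obtain ⟨h, e⟩ := block_fst_of_le g l (Nat.zero_le m)
  rw [List.head?_eq_getElem?, List.getElem?_eq_getElem h] at hx
  obtain rfl := Option.some_injective _ hx
  ext
  simpa [Nat.mod_eq_of_lt] using e

lemma getLast?_block_fst (l : Σ i, G i) : ∀ x ∈ (block g l).getLast?, x.1 = l.1 := by
  intro x hx
  obtain ⟨h, e⟩ := block_fst_of_ge g l (p := 2 * m) (by omega) le_rfl
  rw [List.getLast?_eq_getElem?, length_block, Nat.add_sub_cancel,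
    List.getElem?_eq_getElem h] at hx
  obtain rfl := Option.some_injective _ hx
  ext
  simpa [Nat.mod_eq_of_lt] using e

lemma reduced_flatMap_block (hm : 2 ≤ m) (hg : ∀ i, g i ≠ 1) {q : List (Σ i, G i)}
    (hq : Reduced q) : Reduced (q.flatMap (block g)) := by
  induction q with
  | nil => exact reduced_nil
  | cons l q ih =>
    have hq' := reduced_cons.1 hq
    rw [List.flatMap_cons, reduced_append]
    refine ⟨reduced_block g hm hg hq'.1, ih hq'.2.1, fun x hx y hy => ?_⟩
    rw [getLast?_block_fst g l x hx]
    cases q with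
    | nil => simp at hy
    | cons l' q =>
      have hne : block g l' ≠ [] := by
        rw [← List.length_pos_iff, length_block]
        omega
      rw [List.flatMap_cons, List.head?_append_of_ne_nil _ hne] at hy
      rw [head?_block_fst g l' y hy]
      exact hq'.2.2 l' rfl

lemma listProd_flatMap_block {μ : CoprodI G →* CoprodI G}
    (hμ : ∀ (α : Fin m) (a : G α),
      μ (CoprodI.of a) = (wcyc g α)⁻¹ * CoprodI.of a * wcyc g α) (q : List (Σ i, G i)) :
    listProd (q.flatMap (block g)) = μ (listProd q) := by
  induction q with
  | nil => simp
  | cons l q ih => rw [List.flatMap_cons, listProd_append, ih, listProd_cons, map_mul, hμ,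
      listProd_block]

/-- In the first half of a block the factor index decreases by one at each step. -/
lemma flatMap_block_step_down (q : List (Σ i, G i)) {j : ℕ} (hj : j % (2 * m + 1) < m)
    (hlen : j < (q.flatMap (block g)).length) :
    ∃ t, (q.flatMap (block g))[j]?.map (fun l => (l.1 : ℕ)) = some ((t + 1) % m) ∧
      (q.flatMap (block g))[j + 1]?.map (fun l => (l.1 : ℕ)) = some (t % m) := by
  rw [← Nat.div_add_mod' j (2 * m + 1)] at hlen ⊢
  set r := j % (2 * m + 1)
  obtain ⟨l, hl⟩ := getElem?_flatMap_const (length_block g) q hlen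
  obtain ⟨h1, e1⟩ := block_fst_of_le g l hj.le
  obtain ⟨h2, e2⟩ := block_fst_of_le g l (Nat.succ_le_of_lt hj)
  refine ⟨l.1 + (m - (r + 1)), ?_, ?_⟩
  · rw [hl r (by omega), List.getElem?_eq_getElem h1, Option.map_some, e1]
    congr 2
    omega
  · rw [add_assoc, hl (r + 1) (by omega), List.getElem?_eq_getElem h2, Option.map_some, e2]

/-- In the second half of a block the factor index increases by one at each step. -/
lemma flatMap_block_step_up (q : List (Σ i, G i)) {j : ℕ} (hj : m ≤ j % (2 * m + 1))
    (hj' : j % (2 * m + 1) < 2 * m) (hlen : j < (q.flatMap (block g)).length) :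
    ∃ t, (q.flatMap (block g))[j]?.map (fun l => (l.1 : ℕ)) = some (t % m) ∧
      (q.flatMap (block g))[j + 1]?.map (fun l => (l.1 : ℕ)) = some ((t + 1) % m) := by
  rw [← Nat.div_add_mod' j (2 * m + 1)] at hlen ⊢
  set r := j % (2 * m + 1)
  obtain ⟨l, hl⟩ := getElem?_flatMap_const (length_block g) q hlen
  obtain ⟨h1, e1⟩ := block_fst_of_ge g l hj hj'.le
  obtain ⟨h2, e2⟩ := block_fst_of_ge g l (hj.trans (Nat.le_succ _)) (Nat.succ_le_of_lt hj')
  refine ⟨l.1 + r, ?_, ?_⟩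
  · rw [hl r (by omega), List.getElem?_eq_getElem h1, Option.map_some, e1]
  · rw [add_assoc, hl (r + 1) (by omega), List.getElem?_eq_getElem h2, Option.map_some, e2]
    rfl

lemma not_shifted_overlap (hm : 3 ≤ m) (p q : List (Σ i, G i)) {a s k : ℕ} (hk : 1 ≤ k)
    (hkm : k ≤ m) (hs : s ≡ a + k [MOD 2 * m + 1])
    (ha : a + (2 * m + 1) ≤ (p.flatMap (block g)).length)
    (hs' : s + (2 * m + 1) ≤ (q.flatMap (block g)).length)
    (h : ∀ i ≤ 2 * m + 1, (p.flatMap (block g))[a + i]? = (q.flatMap (block g))[s + i]?) :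
    False := by
  obtain ⟨i, hi, hia⟩ := exists_add_mod_eq (N := 2 * m + 1) a (m - 1) (by omega)
  have his : (s + i) % (2 * m + 1) = m - 1 + k := by
    have h1 : s + i ≡ m - 1 + k [MOD 2 * m + 1] := by
      refine (hs.add_right i).trans ?_
      rw [show a + k + i = a + i + k by ring]
      exact Nat.ModEq.add_right k (by rw [Nat.ModEq, hia, Nat.mod_eq_of_lt (by omega)])
    rwa [Nat.ModEq, Nat.mod_eq_of_lt (by omega : m - 1 + k < 2 * m + 1)] at h1
  obtain ⟨t, h1, h2⟩ := flatMap_block_step_down g p (j := a + i) (by omega) (by omega)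
  obtain ⟨u, h3, h4⟩ := flatMap_block_step_up g q (j := s + i) (by omega) (by omega) (by omega)
  rw [h i hi.le, h3, Option.some_inj] at h1
  rw [add_assoc, h (i + 1) hi, ← add_assoc, h4, Option.some_inj] at h2
  have h5 : t + 2 ≡ t + 0 [MOD m] :=
    (Nat.ModEq.add_right 1 (Eq.symm h1 : t + 1 ≡ u [MOD m])).trans h2
  have h6 := Nat.le_of_dvd two_pos
    (Nat.modEq_zero_iff_dvd.1 (Nat.ModEq.add_left_cancel' t h5))
  omega

/-- Two concatenations of blocks which agree on a long stretch have matching block boundaries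
there. -/
lemma modEq_of_overlap (hm : 3 ≤ m) (p q : List (Σ i, G i)) {a s : ℕ}
    (ha : a + (2 * m + 1) ≤ (p.flatMap (block g)).length)
    (hs : s + (2 * m + 1) ≤ (q.flatMap (block g)).length)
    (h : ∀ i ≤ 2 * m + 1, (p.flatMap (block g))[a + i]? = (q.flatMap (block g))[s + i]?) :
    a ≡ s [MOD 2 * m + 1] := by
  obtain ⟨k, hk, hka⟩ := exists_add_mod_eq (N := 2 * m + 1) a (s % (2 * m + 1))
    (Nat.mod_lt _ (by omega))
  rcases Nat.eq_zero_or_pos k with rfl | hk0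
  · exact hka
  rcases le_or_gt k m with hkm | hkm
  · exact (not_shifted_overlap g hm p q hk0 hkm hka.symm ha hs h).elim
  · refine (not_shifted_overlap g hm q p (k := 2 * m + 1 - k) (by omega) (by omega) ?_ hs ha
      fun i hi => (h i hi).symm).elim
    refine Nat.ModEq.trans ?_ (Nat.ModEq.add_right (2 * m + 1 - k) hka)
    rw [show a + k + (2 * m + 1 - k) = a + (2 * m + 1) by omega, Nat.ModEq, Nat.add_mod_right]

/-- A reduced word that begins like one concatenation of blocks and ends like another one, with a
long overlap, represents an element of the image of `μ`. -/
lemma listProd_mem_range_of_overlap (hm : 3 ≤ m) {μ : CoprodI G →* CoprodI G}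
    (hμ : ∀ (α : Fin m) (a : G α),
      μ (CoprodI.of a) = (wcyc g α)⁻¹ * CoprodI.of a * wcyc g α)
    (p q L : List (Σ i, G i)) {a : ℕ}
    (hX : (p.flatMap (block g)).drop a <:+ L)
    (hY : (q.flatMap (block g)).take ((q.flatMap (block g)).length - a) <+: L)
    (hL : L.length ≤ (q.flatMap (block g)).length + a)
    (hlen : 3 * a + 2 * (2 * m + 1) ≤ (p.flatMap (block g)).length) :
    listProd L ∈ μ.range := by
  set X := p.flatMap (block g) with hXdef
  set Y := q.flatMap (block g) with hYdef
  obtain ⟨S, hS⟩ := hX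
  obtain ⟨T, hT⟩ := hY
  set s := S.length with hsdef
  have hSL : s + (X.length - a) = L.length := by
    rw [← hS, List.length_append, List.length_drop]
  have hTL : Y.length - a + T.length = L.length := by
    rw [← hT, List.length_append, List.length_take, min_eq_left (Nat.sub_le _ _)]
  have hse : s + 2 * (2 * m + 1) ≤ Y.length - a := by omega
  have hLX : ∀ i, L[s + i]? = X[a + i]? := fun i => by
    rw [← hS, List.getElem?_append_right (Nat.le_add_right _ _), Nat.add_sub_cancel_left,
      List.getElem?_drop]
  have hLY : ∀ i < 2 * (2 * m + 1), L[s + i]? = Y[s + i]? := fun i hi => by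
    rw [← hT, List.getElem?_append_left (by rw [List.length_take]; omega),
      List.getElem?_take_of_lt (by omega)]
  have hmod := modEq_of_overlap g hm p q (a := a) (s := s) (by rw [← hXdef]; omega)
    (by rw [← hYdef]; omega) fun i hi => by rw [← hXdef, ← hYdef, ← hLX, hLY i (by omega)]
  obtain ⟨i, hi, hsi⟩ := exists_add_mod_eq (N := 2 * m + 1) s 0 (by omega)
  have hai : (a + i) % (2 * m + 1) = 0 :=
    (show (a + i) % (2 * m + 1) = (s + i) % (2 * m + 1) from hmod.add_right i).trans hsi
  have htake : L.take (s + i) = Y.take (s + i) := by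
    rw [← hT, List.take_append_of_le_length (by rw [List.length_take]; omega), List.take_take,
      min_eq_left (by omega)]
  have hdrop : L.drop (s + i) = X.drop (a + i) := by
    rw [← hS, hsdef, List.drop_length_add_append, List.drop_drop]
  rw [← List.take_append_drop (s + i) L, htake, hdrop, listProd_append,
    ← Nat.div_mul_cancel (Nat.dvd_of_mod_eq_zero hsi),
    ← Nat.div_mul_cancel (Nat.dvd_of_mod_eq_zero hai),
    take_flatMap_const (length_block g), drop_flatMap_const (length_block g),
    listProd_flatMap_block g hμ, listProd_flatMap_block g hμ, ← map_mul]
  exact ⟨_, rfl⟩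

/-- If `W` conjugates `μ x` to `μ y`, where all powers of `x` are given by reduced words without
cancellation, then `W` lies in the image of `μ`. -/
lemma mem_range_of_conj (hm : 3 ≤ m) (hg : ∀ i, g i ≠ 1) {μ : CoprodI G →* CoprodI G}
    (hμ : ∀ (α : Fin m) (a : G α),
      μ (CoprodI.of a) = (wcyc g α)⁻¹ * CoprodI.of a * wcyc g α)
    {P : List (Σ i, G i)} (hP : Reduced P) (hne : P ≠ [])
    (hc : ∀ x ∈ P.head?, ∀ y ∈ P.getLast?, y.1 ≠ x.1) {W y : CoprodI G}
    (h : W * μ (listProd P) * W⁻¹ = μ y) : W ∈ μ.range := by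
  obtain ⟨A, hA, rfl⟩ := exists_reduced W
  set n := 3 * A.length + 2 with hn
  obtain ⟨q, hq, hqy⟩ := exists_reduced (y ^ n)
  set p := (List.replicate n P).flatten with hp
  have hpred : Reduced p := flatten_replicate_reduced hP hne hc n
  have hpl : n ≤ p.length := by
    have := Nat.mul_le_mul_left n (List.length_pos_iff.2 hne)
    simpa [hp] using this
  obtain ⟨L, hL, hLz⟩ := exists_reduced (listProd A * μ (listProd p))
  have hLz' : listProd L = μ (listProd q) * listProd A := by
    rw [hLz, hqy, hp, listProd_flatten_replicate, map_pow, map_pow, ← h, conj_pow]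
    group
  have hX := reduced_flatMap_block g (by omega) hg hpred
  have hY := reduced_flatMap_block g (by omega) hg hq
  rw [← listProd_flatMap_block g hμ] at hLz hLz'
  have hmem := listProd_mem_range_of_overlap g hm hμ p q L (hA.drop_suffix hX hL hLz)
    (hA.take_prefix hY hL hLz')
    (by
      have := hA.inv.length_le hY.inv hL.inv (by simp [hLz'])
      simpa using this)
    (by
      rw [length_flatMap_const (length_block g)]
      calc 3 * A.length + 2 * (2 * m + 1) ≤ n * (2 * m + 1) := by rw [hn]; nlinarith
        _ ≤ _ := Nat.mul_le_mul_right _ hpl)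
  rw [hLz, listProd_flatMap_block g hμ] at hmem
  exact (Subgroup.mul_mem_cancel_right _ (MonoidHom.mem_range.2 ⟨_, rfl⟩)).1 hmem

end Blocks

end FreeProductWord

/-- Lemma 5.3(b): the image `μ(F)` is an antinormal subgroup of `F`:
if `W μ(F) W⁻¹ ∩ μ(F) ≠ {1}` then `W ∈ μ(F)`. -/
theorem statement12 {m : ℕ} (hm : 3 ≤ m) {G : Fin m → Type} [∀ i, Group (G i)]
    [∀ i, Nontrivial (G i)] (g : ∀ i, G i) (hg : ∀ i, g i ≠ 1)
    (μ : CoprodI G →* CoprodI G)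
    (hμ : ∀ (α : Fin m) (a : G α),
      μ (CoprodI.of a) = (wcyc g α)⁻¹ * CoprodI.of a * wcyc g α) :
    ∀ W : CoprodI G, μ.range ⊓ conjS W μ.range ≠ ⊥ → W ∈ μ.range := by
  intro W hW
  rw [Subgroup.ne_bot_iff_exists_ne_one] at hW
  obtain ⟨⟨z, ⟨y, hy⟩, _, ⟨x, rfl⟩, hx⟩, hz1⟩ := hW
  replace hz1 : z ≠ 1 := fun h => hz1 (Subtype.ext h)
  replace hx : W * μ x * W⁻¹ = μ y := hx.trans hy.symm
  subst hy
  obtain ⟨K, hK, rfl⟩ := FreeProductWord.exists_reduced x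
  obtain ⟨M, hM, rfl⟩ := FreeProductWord.exists_reduced y
  obtain ⟨u, hu⟩ := FreeProductWord.exists_conj K hK
  obtain ⟨v, hv⟩ := FreeProductWord.exists_conj M hM
  set x := FreeProductWord.listProd K
  set y := FreeProductWord.listProd M
  have hV : (μ v * W * (μ u)⁻¹) * μ (u * x * u⁻¹) * (μ v * W * (μ u)⁻¹)⁻¹ =
      μ (v * y * v⁻¹) := by
    simp only [map_mul, map_inv, ← hx]
    group
  have hV' : μ (v * y * v⁻¹) ≠ 1 := by
    rw [map_mul, map_mul, map_inv, Ne, conj_eq_one_iff]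
    exact hz1
  suffices hmem : μ v * W * (μ u)⁻¹ ∈ μ.range by
    rwa [Subgroup.mul_mem_cancel_right _ (inv_mem (MonoidHom.mem_range.2 ⟨u, rfl⟩)),
      Subgroup.mul_mem_cancel_left _ (MonoidHom.mem_range.2 ⟨v, rfl⟩)] at hmem
  generalize μ v * W * (μ u)⁻¹ = V at hV
  generalize u * x * u⁻¹ = x' at hu hV
  generalize v * y * v⁻¹ = y' at hv hV hV'
  obtain rfl | ⟨⟨α, a⟩, rfl⟩ | ⟨P, hP, hne, hc, rfl⟩ := hu
  · simp [← hV] at hV'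
  · obtain rfl | ⟨⟨β, b⟩, rfl⟩ | ⟨P, hP, hne, hc, rfl⟩ := hv
    · simp at hV'
    · have ha : a ≠ 1 := by
        rintro rfl
        simp [← hV] at hV'
      have hb : b ≠ 1 := by
        rintro rfl
        simp at hV'
      have h : (wcyc g β * V * (wcyc g α)⁻¹) * CoprodI.of a * (wcyc g β * V * (wcyc g α)⁻¹)⁻¹ =
          CoprodI.of b := by
        calc _ = wcyc g β * (V * ((wcyc g α)⁻¹ * CoprodI.of a * wcyc g α) * V⁻¹) *
              (wcyc g β)⁻¹ := by group
          _ = _ := by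
            rw [← hμ, hV, hμ]
            group
      obtain ⟨rfl, c, hcV⟩ := FreeProductWord.eq_and_mem_of_conj ha hb h
      refine ⟨CoprodI.of c, ?_⟩
      rw [hμ, ← hcV]
      group
    · have hV2 : V⁻¹ * μ (FreeProductWord.listProd P) * V⁻¹⁻¹ = μ (CoprodI.of a) := by
        rw [← hV]
        group
      exact inv_mem_iff.1 (FreeProductWord.mem_range_of_conj g hm hg hμ hP hne hc hV2)
  · exact FreeProductWord.mem_range_of_conj g hm hg hμ hP hne hc hV
end

section
/- Let F = G1 ∗ ⋯ ∗ G_m be the free product of m ≥ 3 nontrivial groups, fix nontrivial g_α ∈ G_α, set w_α := g_{α+1}⋯g_m·g_1⋯g_α, and let μ: F → F be the homomorphism with μ(a) = w_α⁻¹ a w_α for a ∈ G_α. If K1 and K2 are finitely generated factor-free subgroups of F, then r̄(K1, K2) = r̄(μ(K1), μ(K2)). -/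
open Monoid

namespace FreeProductWords

open CoprodI

section Letters

variable {ι : Type*} {G : ι → Type*}

/-- The index of the first letter. -/
def headIdx (l : List (Σ i, G i)) : Option ι := l.head?.map Sigma.fst

/-- The index of the last letter. -/
def lastIdx (l : List (Σ i, G i)) : Option ι := l.getLast?.map Sigma.fst

theorem headIdx_append_of_ne_nil {l₁ : List (Σ i, G i)} (h : l₁ ≠ []) (l₂ : List (Σ i, G i)) :
    headIdx (l₁ ++ l₂) = headIdx l₁ := by
  simp [headIdx, List.head?_append_of_ne_nil _ h]

theorem lastIdx_append_of_ne_nil (l₁ : List (Σ i, G i)) {l₂ : List (Σ i, G i)} (h : l₂ ≠ []) :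
    lastIdx (l₁ ++ l₂) = lastIdx l₂ := by
  simp [lastIdx, List.getLast?_append_of_ne_nil _ h]

variable [∀ i, Group (G i)]

/-- The element of the free product spelled by a list of letters. -/
def lprod (l : List (Σ i, G i)) : CoprodI G := (l.map fun x => of x.2).prod

/-- The formal inverse of a list of letters. -/
def linv (l : List (Σ i, G i)) : List (Σ i, G i) :=
  (l.map fun x => (⟨x.1, x.2⁻¹⟩ : Σ i, G i)).reverse

/-- A list of letters is reduced if no letter is trivial and neighbours lie in distinct factors. -/
def Reduced (l : List (Σ i, G i)) : Prop :=
  (∀ x ∈ l, x.2 ≠ 1) ∧ l.IsChain fun x y => x.1 ≠ y.1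

@[simp] theorem lprod_nil : lprod ([] : List (Σ i, G i)) = 1 := rfl

@[simp] theorem lprod_cons (x : Σ i, G i) (l : List (Σ i, G i)) :
    lprod (x :: l) = of x.2 * lprod l := by simp [lprod]

@[simp] theorem lprod_append (l₁ l₂ : List (Σ i, G i)) :
    lprod (l₁ ++ l₂) = lprod l₁ * lprod l₂ := by simp [lprod]

@[simp] theorem linv_cons (x : Σ i, G i) (l : List (Σ i, G i)) :
    linv (x :: l) = linv l ++ [⟨x.1, x.2⁻¹⟩] := by simp [linv]

@[simp] theorem length_linv (l : List (Σ i, G i)) : (linv l).length = l.length := by simp [linv]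

@[simp] theorem headIdx_linv (l : List (Σ i, G i)) : headIdx (linv l) = lastIdx l := by
  simp [headIdx, lastIdx, linv, List.getLast?_map, Function.comp_def]

@[simp] theorem lastIdx_linv (l : List (Σ i, G i)) : lastIdx (linv l) = headIdx l := by
  simp [headIdx, lastIdx, linv, Function.comp_def]

@[simp] theorem lprod_linv (l : List (Σ i, G i)) : lprod (linv l) = (lprod l)⁻¹ := by
  induction l with
  | nil => simp [linv]
  | cons x l ih => simp [ih]

theorem Reduced.nil : Reduced ([] : List (Σ i, G i)) := ⟨by simp, List.isChain_nil⟩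

theorem reduced_append {l₁ l₂ : List (Σ i, G i)} :
    Reduced (l₁ ++ l₂) ↔ Reduced l₁ ∧ Reduced l₂ ∧
      ∀ i ∈ lastIdx l₁, ∀ j ∈ headIdx l₂, i ≠ j := by
  simp only [Reduced, List.isChain_append, lastIdx, headIdx, List.mem_append, Option.mem_def,
    Option.map_eq_some_iff, forall_exists_index, and_imp]
  constructor
  · rintro ⟨h, h1, h2, h3⟩
    refine ⟨⟨fun x hx => h x (.inl hx), h1⟩, ⟨fun x hx => h x (.inr hx), h2⟩, ?_⟩
    rintro _ x hx rfl _ y hy rfl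
    exact h3 x hx y hy
  · rintro ⟨⟨h1, h1'⟩, ⟨h2, h2'⟩, h3⟩
    exact ⟨fun x hx => hx.elim (h1 x) (h2 x), h1', h2', fun x hx y hy => h3 _ x hx rfl _ y hy rfl⟩

theorem reduced_cons {x : Σ i, G i} {l : List (Σ i, G i)} :
    Reduced (x :: l) ↔ x.2 ≠ 1 ∧ Reduced l ∧ headIdx l ≠ some x.1 := by
  rw [← List.singleton_append, reduced_append]
  simp [Reduced, lastIdx, eq_comm]
  grind

theorem Reduced.linv {l : List (Σ i, G i)} (h : Reduced l) : Reduced (linv l) := by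
  refine ⟨?_, ?_⟩
  · intro x hx
    simp only [FreeProductWords.linv, List.mem_reverse, List.mem_map] at hx
    obtain ⟨y, hy, rfl⟩ := hx
    simpa using h.1 y hy
  · rw [FreeProductWords.linv, List.isChain_reverse, List.isChain_map]
    exact h.2.imp fun _ _ => Ne.symm

end Letters

section NormalForm

variable {ι : Type*} [DecidableEq ι] {G : ι → Type*} [∀ i, Group (G i)] [∀ i, DecidableEq (G i)]

/-- The reduced list of letters spelling `x`. -/
def nf (x : CoprodI G) : List (Σ i, G i) := (Word.equiv x).toList

theorem nf_reduced (x : CoprodI G) : Reduced (nf x) :=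
  ⟨fun y hy => (Word.equiv x).ne_one y hy, (Word.equiv x).chain_ne⟩

@[simp] theorem lprod_nf (x : CoprodI G) : lprod (nf x) = x :=
  Word.equiv.symm_apply_apply x

theorem Reduced.nf_lprod {l : List (Σ i, G i)} (h : Reduced l) : nf (lprod l) = l := by
  have := Word.equiv.apply_symm_apply (⟨l, fun x hx => h.1 x hx, h.2⟩ : Word G)
  exact congrArg Word.toList this

theorem Reduced.nf_eq {l : List (Σ i, G i)} (h : Reduced l) {x : CoprodI G} (hx : lprod l = x) :
    nf x = l := hx ▸ h.nf_lprod

@[simp] theorem nf_one : nf (1 : CoprodI G) = [] := Reduced.nil.nf_lprod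

theorem nf_eq_nil {x : CoprodI G} : nf x = [] ↔ x = 1 :=
  ⟨fun h => by rw [← lprod_nf x, h, lprod_nil], fun h => by rw [h, nf_one]⟩

theorem nf_inv (x : CoprodI G) : nf x⁻¹ = linv (nf x) :=
  (nf_reduced x).linv.nf_eq (by simp)

/-- Multiplication by a letter either adds a letter, changes the first letter, or cancels it. -/
theorem nf_letter_mul (a : Σ i, G i) (ha : a.2 ≠ 1) (x : CoprodI G) :
    (headIdx (nf x) ≠ some a.1 ∧ nf (of a.2 * x) = a :: nf x) ∨
    (headIdx (nf x) = some a.1 ∧ headIdx (nf (of a.2 * x)) = some a.1 ∧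
      (nf (of a.2 * x)).length = (nf x).length) ∨
    (nf (of a.2 * x)).length + 1 = (nf x).length := by
  obtain ⟨i, a⟩ := a
  by_cases h : headIdx (nf x) = some i
  · right
    have hx := lprod_nf x
    have hr := nf_reduced x
    match hl : nf x with
    | [] => simp [hl, headIdx] at h
    | ⟨j, b⟩ :: t =>
      obtain rfl : j = i := by simpa [hl, headIdx] using h
      rw [hl, lprod_cons] at hx
      rw [hl, reduced_cons] at hr
      by_cases hab : a * b = 1
      · right
        rw [hr.2.1.nf_eq (x := of a * x)]
        · rfl
        · rw [← hx, ← mul_assoc, ← map_mul, hab, map_one, one_mul]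
      · left
        have : Reduced (⟨j, a * b⟩ :: t) := reduced_cons.2 ⟨hab, hr.2⟩
        rw [this.nf_eq (x := of a * x) (by rw [← hx, lprod_cons, map_mul, mul_assoc])]
        simp [headIdx]
  · exact .inl ⟨h, (reduced_cons.2 ⟨ha, nf_reduced x, h⟩).nf_eq (by simp)⟩

theorem length_nf_lprod_le (l : List (Σ i, G i)) : (nf (lprod l)).length ≤ l.length := by
  induction l with
  | nil => simp
  | cons a l ih =>
    rw [lprod_cons]
    by_cases ha : a.2 = 1
    · simpa [ha] using ih.trans (Nat.le_succ _)
    · rcases nf_letter_mul a ha (lprod l) with h | h | h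
      · simp [h.2, ih]
      · simp [h.2.2]; omega
      · simp; omega

/-- Either some letter of a reduced word survives at the front of a product, or the word is
cancelled completely. -/
theorem headIdx_nf_lprod_mul {l : List (Σ i, G i)} (hl : Reduced l) (x : CoprodI G) :
    headIdx (nf (lprod l * x)) = headIdx l ∨
      (nf (lprod l * x)).length + l.length = (nf x).length := by
  induction l with
  | nil => right; simp
  | cons a l ih =>
    obtain ⟨ha, hl, hal⟩ := reduced_cons.1 hl
    rw [lprod_cons, mul_assoc]
    rcases nf_letter_mul a ha (lprod l * x) with h | h | h
    · left; simp [h.2, headIdx]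
    · left; rw [h.2.1]; simp [headIdx]
    · rcases ih hl with h' | h'
      · by_cases hh : headIdx (nf (lprod l * x)) = some a.1
        · exact absurd (h' ▸ hh) hal
        · left
          have : Reduced (a :: nf (lprod l * x)) := reduced_cons.2 ⟨ha, nf_reduced _, hh⟩
          rw [this.nf_eq (by simp)]
          simp [headIdx]
      · right; simp; omega

theorem headIdx_nf_lprod_mul_of_lt {l : List (Σ i, G i)} (hl : Reduced l) {x : CoprodI G}
    (h : (nf x).length < l.length) : headIdx (nf (lprod l * x)) = headIdx l :=
  (headIdx_nf_lprod_mul hl x).resolve_right (by omega)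

theorem lastIdx_nf_mul_lprod_of_lt {l : List (Σ i, G i)} (hl : Reduced l) {x : CoprodI G}
    (h : (nf x).length < l.length) : lastIdx (nf (x * lprod l)) = lastIdx l := by
  have := headIdx_nf_lprod_mul_of_lt hl.linv (x := x⁻¹) (by simpa [nf_inv] using h)
  rwa [lprod_linv, ← mul_inv_rev, nf_inv, headIdx_linv, headIdx_linv] at this

/-- Every element is conjugate to `1`, to a letter, or to a cyclically reduced element. -/
theorem exists_conj_cyclically_reduced (x : CoprodI G) :
    ∃ u c : CoprodI G, x = u * c * u⁻¹ ∧
      (c = 1 ∨ (∃ a : Σ i, G i, c = of a.2) ∨ (nf c ≠ [] ∧ headIdx (nf c) ≠ lastIdx (nf c))) := by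
  induction hn : (nf x).length using Nat.strong_induction_on generalizing x with
  | _ n ih =>
  have hx := lprod_nf x
  by_cases h0 : nf x = []
  · exact ⟨1, 1, by simpa using nf_eq_nil.1 h0, .inl rfl⟩
  obtain ⟨a, l, hl⟩ := List.exists_cons_of_ne_nil h0
  rcases List.eq_nil_or_concat l with rfl | ⟨mid, b, rfl⟩
  · exact ⟨1, of a.2, by rw [← hx, hl]; simp, .inr (.inl ⟨a, rfl⟩)⟩
  by_cases hab : headIdx (nf x) = lastIdx (nf x)
  · obtain ⟨i, a⟩ := a
    obtain ⟨j, b⟩ := b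
    rw [hl, List.concat_eq_append, ← List.cons_append, lastIdx_append_of_ne_nil _ (by simp)] at hab
    obtain rfl : i = j := by simpa [headIdx, lastIdx] using hab
    have hy : (of a)⁻¹ * x * of a = lprod (mid ++ [⟨i, b * a⟩]) := by
      rw [← hx, hl]; simp [mul_assoc]
    obtain ⟨u, c, huc, hc⟩ := ih _ (by
      have := length_nf_lprod_le (mid ++ [(⟨i, b * a⟩ : Σ i, G i)])
      rw [← hy] at this
      simp [hl] at hn this
      omega) ((of a)⁻¹ * x * of a) rfl
    refine ⟨of a * u, c, ?_, hc⟩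
    calc x = of a * ((of a)⁻¹ * x * of a) * (of a)⁻¹ := by group
      _ = _ := by rw [huc]; group
  · exact ⟨1, x, by simp, .inr (.inr ⟨h0, hab⟩)⟩

theorem nf_pow_of_cyclically_reduced {c : CoprodI G} (h0 : nf c ≠ [])
    (hc : headIdx (nf c) ≠ lastIdx (nf c)) (n : ℕ) :
    n ≤ (nf (c ^ n)).length ∧ (n ≠ 0 → headIdx (nf (c ^ n)) = headIdx (nf c)) := by
  induction n with
  | zero => simp
  | succ n ih =>
    have hr : Reduced (nf c ++ nf (c ^ n)) := by
      refine reduced_append.2 ⟨nf_reduced _, nf_reduced _, ?_⟩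
      rintro i hi j hj rfl
      rcases eq_or_ne n 0 with rfl | hn
      · simp [headIdx] at hj
      · rw [ih.2 hn] at hj
        exact hc (hj.trans hi.symm)
    rw [hr.nf_eq (x := c ^ (n + 1)) (by simp [pow_succ'])]
    have := List.length_pos_iff.2 h0
    refine ⟨by simp; omega, fun _ => headIdx_append_of_ne_nil h0 _⟩

end NormalForm

section Malnormal

variable {ι : Type*} {G : ι → Type*} [∀ i, Group (G i)]

/-- The letters of the image of the letter `a` under the endomorphism conjugating the factor `G i`
by the element spelled by `U i`. -/
def block (U : ι → List (Σ i, G i)) (a : Σ i, G i) : List (Σ i, G i) :=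
  linv (U a.1) ++ a :: U a.1

theorem lprod_flatMap_block {U : ι → List (Σ i, G i)} {μ : CoprodI G →* CoprodI G}
    (hμ : ∀ a : Σ i, G i, μ (of a.2) = (lprod (U a.1))⁻¹ * of a.2 * lprod (U a.1))
    (l : List (Σ i, G i)) : lprod (l.flatMap (block U)) = μ (lprod l) := by
  induction l with
  | nil => simp
  | cons a l ih => simp [ih, hμ, block, mul_assoc]

theorem headIdx_block {U : ι → List (Σ i, G i)} (hlast : ∀ i, lastIdx (U i) = some i)
    (a : Σ i, G i) (l : List (Σ i, G i)) : headIdx (block U a ++ l) = some a.1 := by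
  have hne : linv (U a.1) ≠ [] := by
    intro h
    have := hlast a.1
    rw [← headIdx_linv, h] at this
    simp [headIdx] at this
  rw [block, List.append_assoc, headIdx_append_of_ne_nil hne, headIdx_linv, hlast]

theorem lastIdx_block {U : ι → List (Σ i, G i)} (hlast : ∀ i, lastIdx (U i) = some i)
    (a : Σ i, G i) : lastIdx (block U a) = some a.1 := by
  have hne : U a.1 ≠ [] := by
    intro h
    simpa [h, lastIdx] using hlast a.1
  rw [block, ← List.singleton_append, ← List.append_assoc, lastIdx_append_of_ne_nil _ hne, hlast]

variable {R : ι → ι → Prop}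

theorem reduced_block (hR : ∀ i j, R i j → ¬ R j i) {U : ι → List (Σ i, G i)}
    (hone : ∀ i, ∀ x ∈ U i, x.2 ≠ 1)
    (hchain : ∀ a : Σ i, G i, (a :: U a.1).IsChain fun x y => R x.1 y.1)
    {a : Σ i, G i} (ha : a.2 ≠ 1) : Reduced (block U a) := by
  have hne : ∀ i j, R i j → i ≠ j := by
    rintro i _ h rfl
    exact hR _ _ h h
  have h : Reduced (a :: U a.1) :=
    ⟨by simpa [ha] using hone a.1, (hchain a).imp fun _ _ => hne _ _⟩
  obtain ⟨-, h1, h2⟩ := reduced_cons.1 h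
  refine reduced_append.2 ⟨h1.linv, h, ?_⟩
  rw [lastIdx_linv]
  rintro i hi j hj rfl
  obtain rfl : a.1 = i := by simpa [headIdx] using hj
  exact h2 hi

theorem reduced_flatMap_block (hR : ∀ i j, R i j → ¬ R j i) {U : ι → List (Σ i, G i)}
    (hone : ∀ i, ∀ x ∈ U i, x.2 ≠ 1) (hlast : ∀ i, lastIdx (U i) = some i)
    (hchain : ∀ a : Σ i, G i, (a :: U a.1).IsChain fun x y => R x.1 y.1)
    {l : List (Σ i, G i)} (hl : Reduced l) : Reduced (l.flatMap (block U)) := by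
  induction l with
  | nil => exact Reduced.nil
  | cons a l ih =>
    obtain ⟨ha, hl, hal⟩ := reduced_cons.1 hl
    rw [List.flatMap_cons]
    refine reduced_append.2 ⟨reduced_block hR hone hchain ha, ih hl, ?_⟩
    rw [lastIdx_block hlast]
    rintro i hi j hj rfl
    obtain rfl : a.1 = i := by simpa using hi
    match l with
    | [] => simp [headIdx] at hj
    | b :: l =>
      rw [List.flatMap_cons, headIdx_block hlast] at hj
      exact hal hj

/-- In the image of a word, a letter whose two neighbours both have the next index is the centre
of a block. -/
theorem lprod_mul_mem_range (hR : ∀ i j, R i j → ¬ R j i) {U : ι → List (Σ i, G i)}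
    (hchain : ∀ a : Σ i, G i, (a :: U a.1).IsChain fun x y => R x.1 y.1)
    {μ : CoprodI G →* CoprodI G}
    (hμ : ∀ a : Σ i, G i, μ (of a.2) = (lprod (U a.1))⁻¹ * of a.2 * lprod (U a.1))
    {l l₁ l₂ : List (Σ i, G i)} {b y : Σ i, G i}
    (hl : l.flatMap (block U) = l₁ ++ b :: y :: l₂)
    (hb : ∀ i ∈ lastIdx l₁, R b.1 i) (hy : R b.1 y.1) :
    lprod l₁ * lprod (U b.1) ∈ μ.range := by
  induction l generalizing l₁ with
  | nil => simp at hl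
  | cons a l ih =>
    rw [List.flatMap_cons, block, List.append_assoc, List.append_eq_append_iff] at hl
    rcases hl with ⟨t, rfl, ht⟩ | ⟨t, ht, ht'⟩
    · match t with
      | [] =>
        obtain ⟨rfl, -⟩ := List.cons.inj ht
        simp
      | c :: t =>
        rw [List.cons_append, List.cons_append, List.cons.injEq] at ht
        obtain ⟨rfl, ht⟩ := ht
        rw [List.append_eq_append_iff] at ht
        have key : ∀ s, U a.1 ≠ t ++ b :: s := by
          intro s hs
          have h := hchain a
          rw [hs, ← List.cons_append] at h
          have h2 : ∃ z, (a :: t).getLast? = some z := by simp [List.getLast?_cons]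
          obtain ⟨z, hz⟩ := h2
          refine hR _ _ ((List.isChain_append.1 h).2.2 z hz b rfl) (hb _ ?_)
          rw [lastIdx_append_of_ne_nil _ (by simp)]
          simp [lastIdx, hz]
        rcases ht with ⟨s, rfl, hs⟩ | ⟨s, hs, hs'⟩
        · have := ih hs (fun i hi => hb i (by
            rw [← List.cons_append, ← List.append_assoc,
              lastIdx_append_of_ne_nil _ (by rintro rfl; simp [lastIdx] at hi)]
            exact hi))
          have h2 := μ.range.mul_mem (Set.mem_range_self (of a.2)) this
          rw [hμ] at h2
          simpa [mul_assoc] using h2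
        · match s with
          | [] =>
            have := ih (l₁ := []) (by simpa using hs'.symm) (by simp [lastIdx])
            have h2 := μ.range.mul_mem (Set.mem_range_self (of a.2)) this
            rw [hμ] at h2
            simp only [List.append_nil] at hs
            simpa [mul_assoc, hs] using h2
          | c :: s =>
            obtain ⟨rfl, -⟩ := List.cons.inj hs'
            exact absurd hs (key s)
    · match t with
      | [] =>
        obtain ⟨rfl, -⟩ := List.cons.inj ht'
        have := congrArg lprod ht
        simp only [lprod_linv, List.append_nil] at this
        simp [← this]
      | c :: t =>
        rw [List.cons_append, List.cons.injEq] at ht'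
        obtain ⟨rfl, ht'⟩ := ht'
        have h : (linv (U a.1) ++ [a]).IsChain fun x y => R y.1 x.1 := by
          have h := hchain ⟨a.1, a.2⁻¹⟩
          have e : linv (U a.1) ++ [a] = linv (⟨a.1, a.2⁻¹⟩ :: U a.1) := by simp
          rw [e, linv, List.isChain_reverse, List.isChain_map]
          exact h
        rw [ht, List.append_assoc, List.cons_append] at h
        have h := h.right_of_append
        match t with
        | [] =>
          obtain ⟨rfl, -⟩ := List.cons.inj ht'
          exact absurd (by simpa using h) (hR _ _ hy)
        | d :: t =>
          obtain ⟨rfl, -⟩ := List.cons.inj ht'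
          simp only [List.cons_append, List.isChain_cons_cons] at h
          exact absurd h.1 (hR _ _ hy)

variable [DecidableEq ι] [∀ i, DecidableEq (G i)]

theorem injective_of_conj_blocks (hR : ∀ i j, R i j → ¬ R j i) {U : ι → List (Σ i, G i)}
    (hone : ∀ i, ∀ x ∈ U i, x.2 ≠ 1) (hlast : ∀ i, lastIdx (U i) = some i)
    (hchain : ∀ a : Σ i, G i, (a :: U a.1).IsChain fun x y => R x.1 y.1)
    {μ : CoprodI G →* CoprodI G}
    (hμ : ∀ a : Σ i, G i, μ (of a.2) = (lprod (U a.1))⁻¹ * of a.2 * lprod (U a.1)) :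
    Function.Injective μ := by
  refine (injective_iff_map_eq_one μ).2 fun x hx => ?_
  have h := (reduced_flatMap_block hR hone hlast hchain (nf_reduced x)).nf_eq
    (lprod_flatMap_block hμ _)
  rw [lprod_nf, hx, nf_one] at h
  rw [← nf_eq_nil]
  match hl : nf x with
  | [] => rfl
  | a :: l => simp [hl, block] at h

/-- If `s` conjugates the image of a sufficiently long word into the range, it lies in it. -/
theorem mem_range_of_conj_mem (hR : ∀ i j, R i j → ¬ R j i) {U : ι → List (Σ i, G i)}
    (hone : ∀ i, ∀ x ∈ U i, x.2 ≠ 1) (hlast : ∀ i, lastIdx (U i) = some i)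
    (hchain : ∀ a : Σ i, G i, (a :: U a.1).IsChain fun x y => R x.1 y.1)
    {μ : CoprodI G →* CoprodI G}
    (hμ : ∀ a : Σ i, G i, μ (of a.2) = (lprod (U a.1))⁻¹ * of a.2 * lprod (U a.1))
    {s x : CoprodI G} (hx : 2 * (nf s).length < (nf x).length)
    (hs : s * μ x * s⁻¹ ∈ μ.range) : s ∈ μ.range := by
  obtain ⟨l₁, a, l₂, hl, h1, h2⟩ : ∃ l₁ a l₂, nf x = l₁ ++ a :: l₂ ∧
      (nf s).length ≤ l₁.length ∧ (nf s).length ≤ l₂.length :=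
    ⟨(nf x).take (nf s).length, (nf x)[(nf s).length], (nf x).drop ((nf s).length + 1),
      by simp, by simp; omega, by simp; omega⟩
  have hlen : ∀ l : List (Σ i, G i), l.length ≤ (l.flatMap (block U)).length := by
    intro l
    induction l with
    | nil => simp
    | cons a l ih => simp [block]; omega
  have hUne : U a.1 ≠ [] := by
    intro h
    simpa [h, lastIdx] using hlast a.1
  have hUpos := List.length_pos_iff.2 hUne
  have hred := reduced_flatMap_block hR hone hlast hchain (nf_reduced x)
  set P := l₁.flatMap (block U) ++ linv (U a.1) with hP
  set Q := U a.1 ++ l₂.flatMap (block U) with hQ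
  have hPQ : (nf x).flatMap (block U) = P ++ a :: Q := by
    simp [hl, hP, hQ, block, List.flatMap_append]
  have hμx : μ x = lprod P * (of a.2 * lprod Q) := by
    rw [← lprod_cons, ← lprod_append, ← hPQ, lprod_flatMap_block hμ, lprod_nf]
  rw [hPQ] at hred
  obtain ⟨hPr, hQr, hPa⟩ := reduced_append.1 hred
  obtain ⟨ha, hQr, haQ⟩ := reduced_cons.1 hQr
  have hPlast : lastIdx (nf (s * lprod P)) = lastIdx P :=
    lastIdx_nf_mul_lprod_of_lt hPr (by
      have := hlen l₁
      rw [hP, List.length_append, length_linv]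
      omega)
  have hQhead : headIdx (nf (lprod Q * s⁻¹)) = headIdx Q :=
    headIdx_nf_lprod_mul_of_lt hQr (by
      have := hlen l₂
      rw [hQ, List.length_append, nf_inv, length_linv]
      omega)
  have hQU : headIdx Q = headIdx (U a.1) := headIdx_append_of_ne_nil hUne _
  have hPU : lastIdx P = headIdx (U a.1) := by
    rw [hP, lastIdx_append_of_ne_nil _ (by rw [← List.length_pos_iff]; simpa using hUpos),
      lastIdx_linv]
  have hhead : ∀ i ∈ headIdx (U a.1), R a.1 i := by
    intro i hi
    obtain ⟨y, hy, rfl⟩ := Option.map_eq_some_iff.1 hi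
    exact (hchain a).rel_head? hy
  have hred' : Reduced (nf (s * lprod P) ++ a :: nf (lprod Q * s⁻¹)) := by
    refine reduced_append.2 ⟨nf_reduced _, reduced_cons.2 ⟨ha, nf_reduced _, ?_⟩, ?_⟩
    · rwa [hQhead]
    · rw [hPlast]
      simpa [headIdx] using hPa
  obtain ⟨z, hz⟩ := hs
  have hnf : (nf z).flatMap (block U) = nf (s * lprod P) ++ a :: nf (lprod Q * s⁻¹) := by
    rw [← (reduced_flatMap_block hR hone hlast hchain (nf_reduced z)).nf_lprod,
      ← hred'.nf_lprod]
    congr 1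
    rw [lprod_flatMap_block hμ, lprod_nf, hz, hμx]
    simp [mul_assoc]
  obtain ⟨y, t, hyt⟩ : ∃ y t, nf (lprod Q * s⁻¹) = y :: t := by
    refine List.exists_cons_of_ne_nil fun h => hUne ?_
    rw [h, hQU] at hQhead
    simpa [headIdx, eq_comm] using hQhead
  rw [hyt] at hnf
  have hmem := lprod_mul_mem_range hR hchain hμ hnf (by rwa [hPlast, hPU])
    (hhead _ (by rw [← hQU, ← hQhead, hyt]; rfl))
  have hmem' : lprod P * lprod (U a.1) ∈ μ.range := by
    refine ⟨lprod l₁, ?_⟩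
    rw [hP, lprod_append, lprod_flatMap_block hμ]
    simp
  rw [lprod_nf, mul_assoc] at hmem
  exact (Subgroup.mul_mem_cancel_right _ hmem').1 hmem

/-- If `s` conjugates all powers of the image of `x` into the range, then `s` lies in the range,
unless `x` is conjugate into a factor. -/
theorem mem_range_of_conj_pow_mem (hR : ∀ i j, R i j → ¬ R j i) {U : ι → List (Σ i, G i)}
    (hone : ∀ i, ∀ x ∈ U i, x.2 ≠ 1) (hlast : ∀ i, lastIdx (U i) = some i)
    (hchain : ∀ a : Σ i, G i, (a :: U a.1).IsChain fun x y => R x.1 y.1)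
    {μ : CoprodI G →* CoprodI G}
    (hμ : ∀ a : Σ i, G i, μ (of a.2) = (lprod (U a.1))⁻¹ * of a.2 * lprod (U a.1))
    {s x : CoprodI G} (hx1 : x ≠ 1)
    (hx : ∀ (u : CoprodI G) (a : Σ i, G i), x ≠ u * of a.2 * u⁻¹)
    (hs : s * μ x * s⁻¹ ∈ μ.range) : s ∈ μ.range := by
  obtain ⟨u, c, huc, rfl | ⟨a, rfl⟩ | ⟨hc0, hc⟩⟩ := exists_conj_cyclically_reduced x
  · exact absurd (by simpa using huc) hx1
  · exact absurd huc (hx u a)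
  · have hsu : s * μ u ∈ μ.range := by
      refine mem_range_of_conj_mem hR hone hlast hchain hμ
        (x := c ^ (2 * (nf (s * μ u)).length + 1))
        (lt_of_lt_of_le (Nat.lt_succ_self _) (nf_pow_of_cyclically_reduced hc0 hc _).1) ?_
      rw [map_pow, ← conj_pow]
      refine Subgroup.pow_mem _ ?_ _
      rw [huc] at hs
      simpa [mul_assoc] using hs
    exact (Subgroup.mul_mem_cancel_right _ (Set.mem_range_self u)).1 hsu

end Malnormal

section Rank

variable {F : Type} [Group F]

theorem rk_map_of_injective {φ : F →* F} (hφ : Function.Injective φ) (H : Subgroup F) :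
    rk (H.map φ) = rk H := by
  classical
  unfold rk
  congr 1
  ext n
  constructor
  · rintro ⟨S, rfl, hS⟩
    have hsub : (S : Set F) ⊆ Set.range φ := fun x hx => by
      obtain ⟨y, -, rfl⟩ := (hS ▸ Subgroup.subset_closure hx : x ∈ H.map φ)
      exact ⟨y, rfl⟩
    have himg : (S.preimage φ hφ.injOn).image φ = S :=
      Finset.coe_injective (by simpa [Set.image_preimage_eq_iff] using hsub)
    refine ⟨S.preimage φ hφ.injOn, ?_, ?_⟩
    · rw [← Finset.card_image_of_injective _ hφ, himg]
    · apply Subgroup.map_injective hφ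
      rw [MonoidHom.map_closure, ← Finset.coe_image, himg, hS]
  · rintro ⟨S, rfl, hS⟩
    exact ⟨S.image φ, Finset.card_image_of_injective _ hφ, by
      rw [Finset.coe_image, ← MonoidHom.map_closure, hS]⟩

theorem rrk_map_of_injective {φ : F →* F} (hφ : Function.Injective φ) (H : Subgroup F) :
    rrk (H.map φ) = rrk H := by
  rw [rrk, rk_map_of_injective hφ, rrk]

theorem rrk_bot : rrk (⊥ : Subgroup F) = 0 := by
  have : rk (⊥ : Subgroup F) ≤ 0 := Nat.sInf_le ⟨∅, rfl, by simp⟩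
  unfold rrk
  omega

theorem mem_conjS {t x : F} {K : Subgroup F} : x ∈ conjS t K ↔ ∃ k ∈ K, t * k * t⁻¹ = x := by
  simp [conjS, Subgroup.mem_map]

theorem conjS_conjS (s t : F) (K : Subgroup F) : conjS s (conjS t K) = conjS (s * t) K := by
  simp [conjS, Subgroup.map_map]
  rfl

theorem conjS_eq_self {k : F} {K : Subgroup F} (hk : k ∈ K) : conjS k K = K := by
  ext x
  rw [mem_conjS]
  refine ⟨?_, fun hx => ⟨k⁻¹ * x * k, K.mul_mem (K.mul_mem (K.inv_mem hk) hx) hk, by group⟩⟩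
  rintro ⟨y, hy, rfl⟩
  exact K.mul_mem (K.mul_mem hk hy) (K.inv_mem hk)

theorem rrk_conjS (t : F) (K : Subgroup F) : rrk (conjS t K) = rrk K :=
  rrk_map_of_injective (MulAut.conj t).injective K

theorem conjS_inf (t : F) (H K : Subgroup F) : conjS t (H ⊓ K) = conjS t H ⊓ conjS t K :=
  Subgroup.map_inf _ _ _ (MulAut.conj t).injective

/-- The reduced rank of `H ∩ s K s⁻¹` depends only on the double coset `H s K`. -/
theorem rrk_inf_conjS_of_rel {H K : Subgroup F} {s t : F} (h : dcSetoid H K s t) :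
    rrk (H ⊓ conjS s K) = rrk (H ⊓ conjS t K) := by
  obtain ⟨h, hh, k, hk, rfl⟩ := h
  rw [← rrk_conjS h, conjS_inf, conjS_eq_self hh, conjS_conjS, ← conjS_conjS (h * s) k,
    conjS_eq_self hk]

theorem rrk_inf_conjS_out {H K : Subgroup F} (s : F) :
    rrk (H ⊓ conjS (Quotient.mk (dcSetoid H K) s).out K) = rrk (H ⊓ conjS s K) :=
  rrk_inf_conjS_of_rel (Quotient.mk_out (s := dcSetoid H K) s)

theorem map_conjS (φ : F →* F) (t : F) (K : Subgroup F) :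
    (conjS t K).map φ = conjS (φ t) (K.map φ) := by
  ext x
  simp only [Subgroup.mem_map, mem_conjS]
  constructor
  · rintro ⟨_, ⟨k, hk, rfl⟩, rfl⟩
    exact ⟨φ k, ⟨k, hk, rfl⟩, by simp⟩
  · rintro ⟨_, ⟨k, hk, rfl⟩, rfl⟩
    exact ⟨t * k * t⁻¹, ⟨k, hk, rfl⟩, by simp⟩

/-- An injective endomorphism preserves the total reduced rank of the intersections if the double
cosets outside its range contribute nothing. -/
theorem rrkInter_map {φ : F →* F} (hφ : Function.Injective φ) {H K : Subgroup F}
    (h : ∀ s ∉ φ.range, H.map φ ⊓ conjS s (K.map φ) = ⊥) :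
    rrkInter (H.map φ) (K.map φ) = rrkInter H K := by
  let f : Quotient (dcSetoid H K) → Quotient (dcSetoid (H.map φ) (K.map φ)) :=
    Quotient.map' φ (by
      rintro s t ⟨a, ha, b, hb, rfl⟩
      exact ⟨φ a, Subgroup.mem_map_of_mem _ ha, φ b, Subgroup.mem_map_of_mem _ hb, by simp⟩)
  have hf : Function.Injective f := by
    intro p q
    induction p using Quotient.inductionOn
    induction q using Quotient.inductionOn
    intro h
    obtain ⟨_, ⟨a, ha, rfl⟩, _, ⟨b, hb, rfl⟩, hab⟩ := Quotient.exact h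
    exact Quotient.sound ⟨a, ha, b, hb, hφ (by simpa using hab)⟩
  unfold rrkInter
  have hsupp : Function.support (fun q : Quotient (dcSetoid (H.map φ) (K.map φ)) =>
      rrk (H.map φ ⊓ conjS q.out (K.map φ))) ⊆ Set.range f := by
    intro q hq
    by_contra hqf
    refine hq ?_
    simp only
    rw [h, rrk_bot]
    rintro ⟨t, ht⟩
    refine hqf ⟨Quotient.mk _ t, ?_⟩
    change Quotient.mk _ (φ t) = q
    rw [ht, Quotient.out_eq]
  rw [← finsum_mem_univ, ← finsum_mem_inter_support, Set.univ_inter,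
    ← Set.inter_eq_right.2 hsupp, finsum_mem_inter_support, finsum_mem_range hf]
  refine finsum_congr fun q => ?_
  induction q using Quotient.inductionOn with
  | _ t =>
    change rrk (H.map φ ⊓ conjS (Quotient.mk (dcSetoid (H.map φ) (K.map φ)) (φ t)).out _) = _
    rw [rrk_inf_conjS_out, rrk_inf_conjS_out, ← map_conjS, ← Subgroup.map_inf _ _ _ hφ,
      rrk_map_of_injective hφ]

end Rank

section CyclicWords

variable {m : ℕ} {G : Fin m → Type}

/-- The letters `g_{α+1}, …, g_m, g_1, …, g_α`. -/
def cyclicLetters (g : ∀ i, G i) (α : Fin m) : List (Σ i, G i) :=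
  (List.ofFn fun i => (⟨i, g i⟩ : Σ i, G i)).rotate (α.1 + 1)

@[simp] theorem length_cyclicLetters (g : ∀ i, G i) (α : Fin m) :
    (cyclicLetters g α).length = m := by simp [cyclicLetters]

theorem getElem_cyclicLetters_fst (g : ∀ i, G i) (α : Fin m) (k : ℕ)
    (hk : k < (cyclicLetters g α).length) :
    ((cyclicLetters g α)[k].1 : ℕ) = (k + (α.1 + 1)) % m := by
  simp [cyclicLetters, List.getElem_rotate]

theorem lastIdx_cyclicLetters (g : ∀ i, G i) (α : Fin m) :
    lastIdx (cyclicLetters g α) = some α := by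
  have hm : 0 < m := α.pos
  rw [lastIdx, List.getLast?_eq_getElem?, List.getElem?_eq_getElem (by simp; omega)]
  simp only [Option.map_some, Option.some.injEq]
  apply Fin.ext
  rw [getElem_cyclicLetters_fst, length_cyclicLetters,
    show m - 1 + (α.1 + 1) = α.1 + m by omega, Nat.add_mod_right, Nat.mod_eq_of_lt α.2]

theorem isChain_cons_cyclicLetters (g : ∀ i, G i) (a : Σ i, G i) :
    (a :: cyclicLetters g a.1).IsChain fun x y => y.1.1 = (x.1.1 + 1) % m := by
  rw [List.isChain_iff_getElem]
  intro i hi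
  match i with
  | 0 => simp [getElem_cyclicLetters_fst]
  | i + 1 =>
    simp only [List.getElem_cons_succ, getElem_cyclicLetters_fst, Nat.mod_add_mod]
    congr 1
    omega

variable [∀ i, Group (G i)]

theorem lprod_cyclicLetters (g : ∀ i, G i) (α : Fin m) :
    lprod (cyclicLetters g α) = wcyc g α := by
  rw [cyclicLetters, List.rotate_eq_drop_append_take (by simp), lprod_append, wcyc, lprod,
    lprod, List.map_drop, List.map_take, List.map_ofFn]
  rfl

end CyclicWords

end FreeProductWords

open FreeProductWords

/-- Lemma 5.3(d): for finitely generated factor-free subgroups `K1, K2`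
of `F`, one has `r̄(K1, K2) = r̄(μ(K1), μ(K2))`. -/
theorem statement14 {m : ℕ} (hm : 3 ≤ m) {G : Fin m → Type} [∀ i, Group (G i)]
    [∀ i, Nontrivial (G i)] (g : ∀ i, G i) (hg : ∀ i, g i ≠ 1)
    (μ : CoprodI G →* CoprodI G)
    (hμ : ∀ (α : Fin m) (a : G α),
      μ (CoprodI.of a) = (wcyc g α)⁻¹ * CoprodI.of a * wcyc g α)
    (K1 K2 : Subgroup (CoprodI G)) (h1fg : K1.FG) (h2fg : K2.FG)
    (h1ff : FactorFreeI K1) (h2ff : FactorFreeI K2) :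
    rrkInter K1 K2 = rrkInter (K1.map μ) (K2.map μ) := by
  classical
  have hR : ∀ i j : Fin m, j.1 = (i.1 + 1) % m → ¬ i.1 = (j.1 + 1) % m := by
    intro i j hj hi
    rw [hj, Nat.mod_add_mod] at hi
    have hi' := i.2
    rcases Nat.lt_or_ge (i.1 + 1 + 1) m with h | h
    · rw [Nat.mod_eq_of_lt h] at hi
      omega
    · rw [Nat.mod_eq_sub_mod h, Nat.mod_eq_of_lt (by omega)] at hi
      omega
  have hone : ∀ i, ∀ x ∈ cyclicLetters g i, x.2 ≠ 1 := by
    intro i x hx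
    rw [cyclicLetters, List.mem_rotate, List.mem_ofFn] at hx
    obtain ⟨j, rfl⟩ := hx
    exact hg j
  have hμ' : ∀ a : Σ i, G i, μ (CoprodI.of a.2) =
      (lprod (cyclicLetters g a.1))⁻¹ * CoprodI.of a.2 * lprod (cyclicLetters g a.1) := by
    intro a
    rw [lprod_cyclicLetters, hμ]
  have hinj := injective_of_conj_blocks hR hone (lastIdx_cyclicLetters g)
    (isChain_cons_cyclicLetters g) hμ'
  refine (rrkInter_map hinj fun s hs => ?_).symm
  refine (Subgroup.eq_bot_iff_forall _).2 fun x hx => ?_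
  obtain ⟨hx1, hx2⟩ := Subgroup.mem_inf.1 hx
  obtain ⟨_, ⟨f, hf, rfl⟩, rfl⟩ := mem_conjS.1 hx2
  by_cases hf1 : f = 1
  · simp [hf1]
  refine absurd (mem_range_of_conj_pow_mem hR hone (lastIdx_cyclicLetters g)
    (isChain_cons_cyclicLetters g) hμ' hf1 ?_ (Subgroup.map_le_range _ _ hx1)) hs
  intro u a hfa
  refine hf1 ((Subgroup.eq_bot_iff_forall _).1 (h2ff u a.1) f ⟨hf, ?_⟩)
  exact mem_conjS.2 ⟨_, ⟨a.2, rfl⟩, hfa.symm⟩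
end
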